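/- arXiv:1206.6173 — 2 statements merged into one kernel-verified Lean document; each statement's English description precedes it below -/
import Mathlib

section
/- Let (m; e, f) be a free pseudo-product fundamental graded Lie algebra of type (m, n, μ) over ℂ, and let g = ⊕_{p∈ℤ} g_p be the prolongation of (m; e, f). If g_1 ≠ 0, then g is a finite-dimensional simple graded Lie algebra of type (A_{m+n}, {α_m, α_{m+1}}) (and in particular μ = 2). -/
open scoped TensorProduct

/-- A ℤ-graded Lie algebra (GLA) structure over `ℂ` on a Lie algebra `L`:
a family of finite-dimensional subspaces forming an internal direct sum and
compatible with the bracket. -/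
structure GLA (L : Type) [LieRing L] [LieAlgebra ℂ L] : Type where
  g : ℤ → Submodule ℂ L
  internal : DirectSum.IsInternal g
  bracket_mem : ∀ p q : ℤ, ∀ x ∈ g p, ∀ y ∈ g q, ⁅x, y⁆ ∈ g (p + q)
  findim : ∀ p : ℤ, FiniteDimensional ℂ (g p)

namespace GLA

variable {L : Type} [LieRing L] [LieAlgebra ℂ L]

/-- A GLA is a fundamental graded Lie algebra (FGLA): it is finite-dimensional,
concentrated in negative degrees, `g₋₁ ≠ 0`, and it is generated by `g₋₁`
(i.e. `g_{p-1} = [g_p, g₋₁]` for all `p < 0`). -/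
structure IsFGLA (G : GLA L) : Prop where
  fd : FiniteDimensional ℂ L
  nonneg : ∀ p : ℤ, 0 ≤ p → G.g p = ⊥
  neg_one_ne_bot : G.g (-1) ≠ ⊥
  generated : ∀ p : ℤ, p < 0 →
    G.g (p - 1) = Submodule.span ℂ {z : L | ∃ x ∈ G.g p, ∃ y ∈ G.g (-1), z = ⁅x, y⁆}

/-- A GLA is of the `μ`-th kind (equivalently, of depth `μ`). -/
def IsOfKind (G : GLA L) (μ : ℕ) : Prop :=
  G.g (-(μ : ℤ)) ≠ ⊥ ∧ ∀ p : ℤ, p < -(μ : ℤ) → G.g p = ⊥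

/-- Transitivity of a GLA. -/
def Transitive (G : GLA L) : Prop :=
  ∀ p : ℤ, 0 ≤ p → ∀ x ∈ G.g p,
    (∀ q : ℤ, q < 0 → ∀ y ∈ G.g q, ⁅x, y⁆ = 0) → x = 0

end GLA

/-- `G` is a free fundamental graded Lie algebra of type `(n, μ)`:
it is an FGLA of the `μ`-th kind with `dim g₋₁ = n`, and every surjective linear map
from `g₋₁` onto the degree `-1` part of an FGLA of the `μ`-th kind extends uniquely
to a graded Lie algebra epimorphism. -/
def IsFreeFGLA {L : Type} [LieRing L] [LieAlgebra ℂ L] (G : GLA L) (n μ : ℕ) : Prop :=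
  G.IsFGLA ∧ G.IsOfKind μ ∧ Module.finrank ℂ (G.g (-1)) = n ∧
  ∀ (L' : Type) [LieRing L'] [LieAlgebra ℂ L'] (G' : GLA L'),
    G'.IsFGLA → G'.IsOfKind μ →
    ∀ φ : (G.g (-1)) →ₗ[ℂ] (G'.g (-1)), Function.Surjective φ →
      ∃! Φ : L →ₗ⁅ℂ⁆ L',
        (∀ p : ℤ, ∀ x ∈ G.g p, Φ x ∈ G'.g p) ∧ Function.Surjective Φ ∧
        ∀ x : G.g (-1), Φ (x : L) = (φ x : L')

/-- A pseudo-product FGLA: an FGLA together with nonzero subspaces `e`, `f` with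
`g₋₁ = e ⊕ f` and `[e,e] = [f,f] = 0`. -/
structure IsPPFGLA {L : Type} [LieRing L] [LieAlgebra ℂ L]
    (G : GLA L) (e f : Submodule ℂ L) : Prop where
  fgla : G.IsFGLA
  e_ne_bot : e ≠ ⊥
  f_ne_bot : f ≠ ⊥
  sup_eq : e ⊔ f = G.g (-1)
  inf_eq : e ⊓ f = ⊥
  lie_ee : ∀ x ∈ e, ∀ y ∈ e, ⁅x, y⁆ = (0 : L)
  lie_ff : ∀ x ∈ f, ∀ y ∈ f, ⁅x, y⁆ = (0 : L)

/-- `(G; e, f)` is a free pseudo-product FGLA of type `(m, n, μ)`. -/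
def IsFreePPFGLA {L : Type} [LieRing L] [LieAlgebra ℂ L] (G : GLA L)
    (e f : Submodule ℂ L) (m n μ : ℕ) : Prop :=
  IsPPFGLA G e f ∧ G.IsOfKind μ ∧
  Module.finrank ℂ e = m ∧ Module.finrank ℂ f = n ∧
  ∀ (L' : Type) [LieRing L'] [LieAlgebra ℂ L'] (G' : GLA L') (e' f' : Submodule ℂ L'),
    IsPPFGLA G' e' f' → G'.IsOfKind μ →
    ∀ φ : (G.g (-1)) →ₗ[ℂ] (G'.g (-1)), Function.Surjective φ →
      (∀ x : L, ∀ hx : x ∈ G.g (-1), x ∈ e → (φ ⟨x, hx⟩ : L') ∈ e') →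
      (∀ x : L, ∀ hx : x ∈ G.g (-1), x ∈ f → (φ ⟨x, hx⟩ : L') ∈ f') →
      ∃! Φ : L →ₗ⁅ℂ⁆ L',
        (∀ p : ℤ, ∀ x ∈ G.g p, Φ x ∈ G'.g p) ∧ Function.Surjective Φ ∧
        ∀ x : G.g (-1), Φ (x : L) = (φ x : L')

/-- `G` (on `LG`, with embedding `ι` of `Lm`) is the prolongation of the FGLA `M`:
`ι` embeds `M` as the negative part of `G`, `G` is transitive, and `G` is maximal among
transitive GLAs with negative part `M`. -/
structure IsProlongation {Lm LG : Type} [LieRing Lm] [LieAlgebra ℂ Lm]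
    [LieRing LG] [LieAlgebra ℂ LG] (M : GLA Lm) (G : GLA LG)
    (ι : Lm →ₗ⁅ℂ⁆ LG) : Prop where
  inj : Function.Injective ι
  graded_neg : ∀ p : ℤ, p < 0 → (M.g p).map ι.toLinearMap = G.g p
  trans : G.Transitive
  max : ∀ (LH : Type) [LieRing LH] [LieAlgebra ℂ LH] (H : GLA LH) (j : Lm →ₗ⁅ℂ⁆ LH),
    Function.Injective j → (∀ p : ℤ, p < 0 → (M.g p).map j.toLinearMap = H.g p) →
    H.Transitive →
    ∃ ψ : LH →ₗ⁅ℂ⁆ LG, Function.Injective ψ ∧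
      (∀ p : ℤ, (H.g p).map ψ.toLinearMap ≤ G.g p) ∧ ψ.comp j = ι

/-- `G` (with embedding `ι`) is the prolongation of the pseudo-product FGLA `(M; e, f)`:
the negative part is `M`, `G` is transitive, the degree-0 part preserves `e` and `f`,
and `G` is maximal among such transitive GLAs. -/
structure IsPPProlongation {Lm LG : Type} [LieRing Lm] [LieAlgebra ℂ Lm]
    [LieRing LG] [LieAlgebra ℂ LG] (M : GLA Lm) (e f : Submodule ℂ Lm) (G : GLA LG)
    (ι : Lm →ₗ⁅ℂ⁆ LG) : Prop where
  inj : Function.Injective ι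
  graded_neg : ∀ p : ℤ, p < 0 → (M.g p).map ι.toLinearMap = G.g p
  trans : G.Transitive
  e_stable : ∀ x ∈ G.g 0, ∀ y ∈ e, ⁅x, ι y⁆ ∈ e.map ι.toLinearMap
  f_stable : ∀ x ∈ G.g 0, ∀ y ∈ f, ⁅x, ι y⁆ ∈ f.map ι.toLinearMap
  max : ∀ (LH : Type) [LieRing LH] [LieAlgebra ℂ LH] (H : GLA LH) (j : Lm →ₗ⁅ℂ⁆ LH),
    Function.Injective j → (∀ p : ℤ, p < 0 → (M.g p).map j.toLinearMap = H.g p) →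
    H.Transitive →
    (∀ x ∈ H.g 0, ∀ y ∈ e, ⁅x, j y⁆ ∈ e.map j.toLinearMap) →
    (∀ x ∈ H.g 0, ∀ y ∈ f, ⁅x, j y⁆ ∈ f.map j.toLinearMap) →
    ∃ ψ : LH →ₗ⁅ℂ⁆ LG, Function.Injective ψ ∧
      (∀ p : ℤ, (H.g p).map ψ.toLinearMap ≤ G.g p) ∧ ψ.comp j = ι

/-- `G` is a finite-dimensional simple graded Lie algebra of type `(A, Pi1)`, where `A`
is the Cartan matrix (with convention `⁅hᵢ, eⱼ⁆ = Aᵢⱼ • eⱼ`) and `Pi1` is the set of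
simple roots of degree one: there is a set of Chevalley generators compatible with the
grading, the generators `eᵢ` (resp. `fᵢ`) having degree `1` (resp. `-1`) for `i ∈ Pi1`
and degree `0` otherwise. -/
def IsSimpleGLAOfType {LG : Type} [LieRing LG] [LieAlgebra ℂ LG] (G : GLA LG)
    {l : ℕ} (A : Matrix (Fin l) (Fin l) ℤ) (Pi1 : Finset (Fin l)) : Prop :=
  FiniteDimensional ℂ LG ∧ LieAlgebra.IsSimple ℂ LG ∧
  ∃ h e f : Fin l → LG,
    LinearIndependent ℂ h ∧ (∀ i, e i ≠ 0) ∧ (∀ i, f i ≠ 0) ∧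
    (∀ i j, ⁅h i, h j⁆ = 0) ∧
    (∀ i, ⁅e i, f i⁆ = h i) ∧ (∀ i j, i ≠ j → ⁅e i, f j⁆ = 0) ∧
    (∀ i j, ⁅h i, e j⁆ = A i j • e j) ∧
    (∀ i j, ⁅h i, f j⁆ = (-(A i j)) • f j) ∧
    LieSubalgebra.lieSpan ℂ LG (Set.range e ∪ Set.range f) = ⊤ ∧
    (∀ i, h i ∈ G.g 0) ∧
    (∀ i, e i ∈ G.g (if i ∈ Pi1 then 1 else 0)) ∧
    (∀ i, f i ∈ G.g (-(if i ∈ Pi1 then 1 else 0)))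

/-- The Cartan matrix of type `A_l` (Bourbaki numbering, 0-indexed). -/
def cartanA (l : ℕ) : Matrix (Fin l) (Fin l) ℤ :=
  Matrix.of fun i j =>
    if i = j then 2
    else if (i : ℕ) + 1 = (j : ℕ) ∨ (j : ℕ) + 1 = (i : ℕ) then -1 else 0

/-- The Cartan matrix of type `B_l` (Bourbaki numbering, 0-indexed; the last simple
root is the short one), with convention `⁅hᵢ, eⱼ⁆ = Aᵢⱼ • eⱼ`, i.e. `Aᵢⱼ = αⱼ(hᵢ)`. -/
def cartanB (l : ℕ) : Matrix (Fin l) (Fin l) ℤ :=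
  Matrix.of fun i j =>
    if i = j then 2
    else if (i : ℕ) = l - 1 ∧ (j : ℕ) + 1 = (i : ℕ) then -2
    else if (i : ℕ) + 1 = (j : ℕ) ∨ (j : ℕ) + 1 = (i : ℕ) then -1 else 0

/-- The Cartan matrix of type `G₂` (Bourbaki numbering, 0-indexed; `α₁` is the short
root), with convention `⁅hᵢ, eⱼ⁆ = Aᵢⱼ • eⱼ`, i.e. `Aᵢⱼ = αⱼ(hᵢ)`. -/
def cartanG2 : Matrix (Fin 2) (Fin 2) ℤ := !![2, -3; -1, 2]

/-- A pseudo-product graded Lie algebra: a transitive GLA whose negative part is an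
FGLA equipped with a pseudo-product structure `(e, f)` preserved by `g₀`. -/
structure IsPseudoProductGLA {L : Type} [LieRing L] [LieAlgebra ℂ L]
    (G : GLA L) (e f : Submodule ℂ L) : Prop where
  trans : G.Transitive
  e_ne_bot : e ≠ ⊥
  f_ne_bot : f ≠ ⊥
  sup_eq : e ⊔ f = G.g (-1)
  inf_eq : e ⊓ f = ⊥
  lie_ee : ∀ x ∈ e, ∀ y ∈ e, ⁅x, y⁆ = (0 : L)
  lie_ff : ∀ x ∈ f, ∀ y ∈ f, ⁅x, y⁆ = (0 : L)
  neg_one_ne_bot : G.g (-1) ≠ ⊥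
  generated : ∀ p : ℤ, p < 0 →
    G.g (p - 1) = Submodule.span ℂ {z : L | ∃ x ∈ G.g p, ∃ y ∈ G.g (-1), z = ⁅x, y⁆}
  depth_bdd : ∃ μ : ℕ, ∀ p : ℤ, p < -(μ : ℤ) → G.g p = ⊥
  e_stable : ∀ x ∈ G.g 0, ∀ y ∈ e, ⁅x, y⁆ ∈ e
  f_stable : ∀ x ∈ G.g 0, ∀ y ∈ f, ⁅x, y⁆ ∈ f

/-- The symmetric square `S²(V)` of a vector space, realized as the subspace of
symmetric tensors in `V ⊗ V`. -/
noncomputable def symSq (V : Type) [AddCommGroup V] [Module ℂ V] : Submodule ℂ (TensorProduct ℂ V V) :=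
  LinearMap.eqLocus (TensorProduct.comm ℂ V V).toLinearMap LinearMap.id

lemma tmul_self_mem_symSq {V : Type} [AddCommGroup V] [Module ℂ V] (x : V) :
    x ⊗ₜ[ℂ] x ∈ symSq V := by
  show (TensorProduct.comm ℂ V V).toLinearMap (x ⊗ₜ[ℂ] x) = LinearMap.id (x ⊗ₜ[ℂ] x)
  simp

/-- A family of subspaces of eigenspaces (with integral eigenvalues) that spans is an internal
direct sum decomposition. -/
theorem isInternal_of_le_eigenspace {L : Type} [AddCommGroup L] [Module ℂ L]
    (D : Module.End ℂ L) (g : ℤ → Submodule ℂ L)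
    (hg : ∀ p, g p ≤ D.eigenspace (p : ℂ)) (htop : ⨆ p, g p = ⊤) :
    DirectSum.IsInternal g := by
  refine DirectSum.isInternal_submodule_of_iSupIndep_of_iSup_eq_top ?_ htop
  have h := (Module.End.eigenspaces_iSupIndep D).comp (Int.cast_injective (α := ℂ))
  exact h.mono hg

/-- The filiform Lie algebra `ℂ a ⊕ ⟨v₀, …, v_{k-1}⟩` with `⁅a, vᵢ⁆ = vᵢ₊₁`. -/
structure Filiform (k : ℕ) : Type where
  /-- The coefficient of `a`. -/
  fst : ℂ
  /-- The coefficients of the `vᵢ`. -/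
  snd : Fin k → ℂ

namespace Filiform

variable {k : ℕ}

/-- The underlying pair of coordinates. -/
def toProd : Filiform k ≃ ℂ × (Fin k → ℂ) where
  toFun x := (x.fst, x.snd)
  invFun x := ⟨x.1, x.2⟩

noncomputable instance : AddCommGroup (Filiform k) := toProd.addCommGroup
noncomputable instance : Module ℂ (Filiform k) := toProd.module ℂ
instance : FiniteDimensional ℂ (Filiform k) :=
  Module.Finite.equiv (toProd.linearEquiv ℂ).symm

@[ext] theorem ext {x y : Filiform k} (h1 : x.1 = y.1) (h2 : ∀ i, x.2 i = y.2 i) : x = y := by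
  cases x; cases y
  obtain rfl := h1
  obtain rfl := funext h2
  rfl

@[simp] theorem add_fst (x y : Filiform k) : (x + y).1 = x.1 + y.1 := rfl
@[simp] theorem add_snd (x y : Filiform k) (i : Fin k) : (x + y).2 i = x.2 i + y.2 i := rfl
@[simp] theorem zero_fst : (0 : Filiform k).1 = 0 := rfl
@[simp] theorem zero_snd (i : Fin k) : (0 : Filiform k).2 i = 0 := rfl
@[simp] theorem smul_fst (c : ℂ) (x : Filiform k) : (c • x).1 = c * x.1 := rfl
@[simp] theorem smul_snd (c : ℂ) (x : Filiform k) (i : Fin k) : (c • x).2 i = c * x.2 i := rfl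

/-- The coordinate preceding `i`, or zero. -/
def shift (v : Fin k → ℂ) (i : Fin k) : ℂ :=
  if 0 < i.val then v ⟨i.val - 1, by omega⟩ else 0

@[simp] theorem neg_snd (x : Filiform k) (i : Fin k) : (-x).2 i = -x.2 i := rfl
@[simp] theorem neg_fst (x : Filiform k) : (-x).1 = -x.1 := rfl

noncomputable instance : LieRing (Filiform k) where
  bracket x y := ⟨0, fun i => x.1 * shift y.2 i - y.1 * shift x.2 i⟩
  add_lie x y z := by
    ext i
    · simp
    · simp only [add_fst, add_snd, shift]; split_ifs <;> ring
  lie_add x y z := by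
    ext i
    · simp
    · simp only [add_fst, add_snd, shift]; split_ifs <;> ring
  lie_self x := by
    ext i
    · rfl
    · simp
  leibniz_lie x y z := by
    ext i
    · simp
    · simp only [add_snd, shift]; split_ifs <;> (simp; try ring)

theorem lie_fst (x y : Filiform k) : ⁅x, y⁆.1 = 0 := rfl
theorem lie_snd (x y : Filiform k) (i : Fin k) :
    ⁅x, y⁆.2 i = x.1 * shift y.2 i - y.1 * shift x.2 i := rfl

noncomputable instance : LieAlgebra ℂ (Filiform k) where
  lie_smul c x y := by
    ext i
    · simp [lie_fst]
    · simp only [lie_snd, smul_fst, smul_snd, shift]; split_ifs <;> ring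

/-- The generator `a`. -/
def a : Filiform k := ⟨1, 0⟩
/-- The vector `vᵢ`, zero for `i ≥ k`. -/
def v (i : ℕ) : Filiform k := ⟨0, fun j => if j.val = i then 1 else 0⟩

@[simp] theorem a_fst : (a : Filiform k).1 = 1 := rfl
@[simp] theorem a_snd (i : Fin k) : (a : Filiform k).2 i = 0 := rfl
@[simp] theorem v_fst (i : ℕ) : (v i : Filiform k).1 = 0 := rfl
@[simp] theorem v_snd (i : ℕ) (j : Fin k) :
    (v i : Filiform k).2 j = if j.val = i then 1 else 0 := rfl

@[simp] theorem lie_a_v (i : ℕ) : ⁅(a : Filiform k), (v i : Filiform k)⁆ = v (i + 1) := by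
  ext j
  · simp [lie_fst]
  · simp only [lie_snd, shift, a_fst, v_fst, v_snd]
    split_ifs <;> first | omega | simp

@[simp] theorem lie_v_v (i j : ℕ) : ⁅(v i : Filiform k), (v j : Filiform k)⁆ = 0 := by
  ext l
  · simp [lie_fst]
  · simp [lie_snd]

theorem v_ne_zero {i : ℕ} (h : i < k) : (v i : Filiform k) ≠ 0 := fun h0 => by
  have := congrArg (fun z : Filiform k => z.2 ⟨i, h⟩) h0
  simp at this

theorem eq_sum (x : Filiform k) : x = x.1 • a + ∑ i : Fin k, x.2 i • v i.val := by
  have h1 : ∀ s : Finset (Fin k), (∑ i ∈ s, x.2 i • (v i.val : Filiform k)).1 = 0 := by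
    intro s
    induction s using Finset.cons_induction with
    | empty => rfl
    | cons i s hi ih => rw [Finset.sum_cons, add_fst, ih]; simp
  have h2 : ∀ (s : Finset (Fin k)) (j : Fin k),
      (∑ i ∈ s, x.2 i • (v i.val : Filiform k)).2 j = ∑ i ∈ s, if j.val = i.val then x.2 i else 0 := by
    intro s j
    induction s using Finset.cons_induction with
    | empty => rfl
    | cons i s hi ih => rw [Finset.sum_cons, Finset.sum_cons, add_snd, ih]; simp
  ext j
  · rw [add_fst, h1]; simp
  · rw [add_snd, h2]; simp [Fin.val_inj]

/-- The graded pieces: `a` and `v₀` have degree `-1`, and `vᵢ` has degree `-(i+1)`. -/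
def grade (k : ℕ) (p : ℤ) : Submodule ℂ (Filiform k) where
  carrier := {x | (p ≠ -1 → x.1 = 0) ∧ ∀ i : Fin k, p ≠ -(i.val + 1 : ℤ) → x.2 i = 0}
  add_mem' := fun hx hy => ⟨fun h => by simp [hx.1 h, hy.1 h],
    fun i h => by simp [hx.2 i h, hy.2 i h]⟩
  zero_mem' := ⟨fun _ => rfl, fun _ _ => rfl⟩
  smul_mem' := fun c x hx => ⟨fun h => by simp [hx.1 h], fun i h => by simp [hx.2 i h]⟩

theorem mem_grade {p : ℤ} {x : Filiform k} : x ∈ grade k p ↔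
    (p ≠ -1 → x.1 = 0) ∧ ∀ i : Fin k, p ≠ -(i.val + 1 : ℤ) → x.2 i = 0 := Iff.rfl

theorem a_mem : (a : Filiform k) ∈ grade k (-1) := ⟨fun h => absurd rfl h, fun _ _ => rfl⟩
theorem v_mem (i : ℕ) : (v i : Filiform k) ∈ grade k (-(i + 1 : ℤ)) :=
  ⟨fun _ => rfl, fun j h => by simp only [v_snd, ite_eq_right_iff]; omega⟩

/-- The degree derivation, as a linear map. -/
noncomputable def degree (k : ℕ) : Module.End ℂ (Filiform k) where
  toFun x := ⟨-x.1, fun i => -(i.val + 1 : ℂ) * x.2 i⟩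
  map_add' x y := by
    ext i
    · simp; ring
    · simp; ring
  map_smul' c x := by
    ext i
    · simp
    · simp; ring

/-- The filiform graded Lie algebra. -/
noncomputable def gla (k : ℕ) : GLA (Filiform k) where
  g := grade k
  internal := by
    refine isInternal_of_le_eigenspace (degree k) _ ?_ ?_
    · intro p x hx
      rw [Module.End.mem_eigenspace_iff]
      ext i
      · by_cases h : p = -1
        · subst h; simp [degree]
        · simp [degree, hx.1 h]
      · by_cases h : p = -(i.val + 1 : ℤ)
        · subst h; simp [degree]
        · simp [degree, hx.2 i h]
    · rw [eq_top_iff]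
      intro x _
      rw [eq_sum x]
      refine add_mem (Submodule.smul_mem _ _ (Submodule.mem_iSup_of_mem _ a_mem))
        (sum_mem fun i _ => Submodule.smul_mem _ _ (Submodule.mem_iSup_of_mem _ (v_mem _)))
  bracket_mem p q x hx y hy := by
    refine ⟨fun _ => rfl, fun i hi => ?_⟩
    rw [lie_snd, shift, shift]
    split_ifs with h
    · have e1 : x.1 * y.2 ⟨i.val - 1, by omega⟩ = 0 := by
        by_cases hp : p = -1
        · rw [hy.2 ⟨i.val - 1, by omega⟩ (by simp only; omega), mul_zero]
        · rw [hx.1 hp, zero_mul]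
      have e2 : y.1 * x.2 ⟨i.val - 1, by omega⟩ = 0 := by
        by_cases hp : q = -1
        · rw [hx.2 ⟨i.val - 1, by omega⟩ (by simp only; omega), mul_zero]
        · rw [hy.1 hp, zero_mul]
      rw [e1, e2, sub_zero]
    · simp
  findim p := inferInstance

theorem gla_g (p : ℤ) : (gla k).g p = grade k p := rfl

theorem grade_eq_bot {p : ℤ} (h0 : p ≠ -1) (h : ∀ i : Fin k, p ≠ -(i.val + 1 : ℤ)) :
    grade k p = ⊥ :=
  (Submodule.eq_bot_iff _).2 fun x hx => by
    ext i
    · exact hx.1 h0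
    · exact hx.2 i (h i)

theorem mem_grade_neg_one {x : Filiform k} (hk : 0 < k) (hx : x ∈ grade k (-1)) :
    x = x.1 • a + x.2 ⟨0, hk⟩ • v 0 := by
  ext i
  · simp
  · by_cases h : i.val = 0
    · have : i = ⟨0, hk⟩ := Fin.ext h
      subst this; simp
    · simp [h, hx.2 i (by omega)]

theorem isFGLA : (gla k).IsFGLA where
  fd := inferInstance
  nonneg p hp := grade_eq_bot (by omega) (fun i => by omega)
  neg_one_ne_bot h := by
    have h1 : (a : Filiform k) ∈ (gla k).g (-1) := a_mem
    rw [h, Submodule.mem_bot] at h1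
    simpa using congrArg Filiform.fst h1
  generated p hp := by
    refine le_antisymm ?_ (Submodule.span_le.2 ?_)
    · intro x hx
      rw [gla_g] at hx
      obtain ⟨j, rfl⟩ : ∃ j : ℕ, p = -(j + 1 : ℤ) := ⟨(-p - 1).toNat, by omega⟩
      by_cases hj : j + 1 < k
      · have : x = x.2 ⟨j + 1, hj⟩ • (v (j + 1) : Filiform k) := by
          ext i
          · simp [hx.1 (by omega)]
          · by_cases h : i.val = j + 1
            · have : i = ⟨j + 1, hj⟩ := Fin.ext h
              subst this; simp
            · simp [h, hx.2 i (by omega)]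
        rw [this]
        refine Submodule.smul_mem _ _ (Submodule.subset_span ⟨-v j, neg_mem (v_mem j), a, a_mem, ?_⟩)
        rw [neg_lie, ← lie_skew, neg_neg, lie_a_v]
      · rw [grade_eq_bot (by omega) (fun i => by omega), Submodule.mem_bot] at hx
        rw [hx]; exact zero_mem _
    · rintro _ ⟨x, hx, y, hy, rfl⟩
      exact (gla k).bracket_mem p (-1) x hx y hy

theorem isOfKind (hk : 0 < k) : (gla k).IsOfKind k := by
  refine ⟨fun h => ?_, fun p hp => grade_eq_bot (by omega) fun i => by omega⟩
  have h1 := v_mem (k := k) (k - 1)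
  rw [show (-(((k - 1 : ℕ) : ℤ) + 1)) = -(k : ℤ) by omega, ← gla_g, h, Submodule.mem_bot] at h1
  exact v_ne_zero (by omega) h1

theorem isPPFGLA (hk : 0 < k) :
    IsPPFGLA (gla k) (Submodule.span ℂ {a}) (Submodule.span ℂ {v 0}) where
  fgla := isFGLA
  e_ne_bot h := by
    rw [Submodule.span_singleton_eq_bot] at h
    simpa using congrArg Filiform.fst h
  f_ne_bot h := v_ne_zero hk (Submodule.span_singleton_eq_bot.1 h)
  sup_eq := by
    refine le_antisymm (sup_le ?_ ?_) fun x hx => ?_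
    · rw [Submodule.span_singleton_le_iff_mem]; exact a_mem
    · rw [Submodule.span_singleton_le_iff_mem]; exact v_mem 0
    · rw [mem_grade_neg_one hk hx]
      exact Submodule.add_mem_sup (Submodule.smul_mem _ _ (Submodule.mem_span_singleton_self _))
        (Submodule.smul_mem _ _ (Submodule.mem_span_singleton_self _))
  inf_eq := by
    rw [Submodule.eq_bot_iff]
    rintro x ⟨h1, h2⟩
    obtain ⟨s, rfl⟩ := Submodule.mem_span_singleton.1 h1
    obtain ⟨t, ht⟩ := Submodule.mem_span_singleton.1 h2
    have := congrArg Filiform.fst ht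
    have hs : s = 0 := by
      have h3 : (t • v 0 : Filiform k).1 = (s • a : Filiform k).1 := this
      simpa using h3.symm
    rw [hs, zero_smul]
  lie_ee x hx y hy := by
    obtain ⟨s, rfl⟩ := Submodule.mem_span_singleton.1 hx
    obtain ⟨t, rfl⟩ := Submodule.mem_span_singleton.1 hy
    simp
  lie_ff x hx y hy := by
    obtain ⟨s, rfl⟩ := Submodule.mem_span_singleton.1 hx
    obtain ⟨t, rfl⟩ := Submodule.mem_span_singleton.1 hy
    simp

end Filiform

/-- Test homomorphisms from a free pseudo-product FGLA to the filiform algebra. -/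
theorem IsFreePPFGLA.exists_hom_filiform {L : Type} [LieRing L] [LieAlgebra ℂ L] {M : GLA L}
    {e f : Submodule ℂ L} {m n μ : ℕ} (h : IsFreePPFGLA M e f m n μ) (hμ : 0 < μ)
    (ξ η : Module.Dual ℂ L) (hξ : ∀ y ∈ f, ξ y = 0) (hη : ∀ x ∈ e, η x = 0)
    {x y : L} (hx : x ∈ e) (hy : y ∈ f) (hξx : ξ x = 1) (hηy : η y = 1) :
    ∃ Φ : L →ₗ⁅ℂ⁆ Filiform μ, (∀ z ∈ e, Φ z = ξ z • Filiform.a) ∧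
      ∀ z ∈ f, Φ z = η z • Filiform.v 0 := by
  obtain ⟨hpp, -, -, -, hU⟩ := h
  have he : e ≤ M.g (-1) := hpp.sup_eq ▸ le_sup_left
  have hf : f ≤ M.g (-1) := hpp.sup_eq ▸ le_sup_right
  have hmem : ∀ s t : ℂ, s • (Filiform.a : Filiform μ) + t • Filiform.v 0 ∈ (Filiform.gla μ).g (-1) :=
    fun s t => add_mem (Submodule.smul_mem _ _ Filiform.a_mem)
      (Submodule.smul_mem _ _ (Filiform.v_mem 0))
  let φ : M.g (-1) →ₗ[ℂ] (Filiform.gla μ).g (-1) :=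
    LinearMap.codRestrict _
      (((ξ.smulRight (Filiform.a : Filiform μ)) + η.smulRight (Filiform.v 0)) ∘ₗ
        (M.g (-1)).subtype) (fun z => hmem _ _)
  have hφ : ∀ z, (φ z : Filiform μ) = ξ z • Filiform.a + η z • Filiform.v 0 := fun z => rfl
  have hsurj : Function.Surjective φ := by
    rintro ⟨z, hz⟩
    have h0 := Filiform.mem_grade_neg_one hμ hz
    refine ⟨⟨z.1 • x + z.2 ⟨0, hμ⟩ • y, add_mem (Submodule.smul_mem _ _ (he hx))
      (Submodule.smul_mem _ _ (hf hy))⟩, Subtype.ext ?_⟩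
    rw [hφ]
    refine Eq.trans ?_ h0.symm
    simp [hξ y hy, hη x hx, hξx, hηy]
  obtain ⟨Φ, ⟨-, -, hΦ⟩, -⟩ := hU (Filiform μ) (Filiform.gla μ) _ _ (Filiform.isPPFGLA hμ)
    (Filiform.isOfKind hμ) φ hsurj
    (fun z hz hze => by
      rw [hφ]
      simpa [hη z hze] using Submodule.smul_mem _ _ (Submodule.mem_span_singleton_self _))
    (fun z hz hzf => by
      rw [hφ]
      simpa [hξ z hzf] using Submodule.smul_mem _ _ (Submodule.mem_span_singleton_self _))
  refine ⟨Φ, fun z hz => ?_, fun z hz => ?_⟩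
  · have := hΦ ⟨z, he hz⟩
    rw [hφ] at this
    simpa [hη z hz] using this
  · have := hΦ ⟨z, hf hz⟩
    rw [hφ] at this
    simpa [hξ z hz] using this

/-- A transitive graded Lie algebra extending a pseudo-product FGLA, whose degree-0 part
preserves the pseudo-product structure. -/
structure IsPPExtension {Lm LG : Type} [LieRing Lm] [LieAlgebra ℂ Lm]
    [LieRing LG] [LieAlgebra ℂ LG] (M : GLA Lm) (e f : Submodule ℂ Lm) (G : GLA LG)
    (ι : Lm →ₗ⁅ℂ⁆ LG) : Prop where
  inj : Function.Injective ι
  graded_neg : ∀ p : ℤ, p < 0 → (M.g p).map ι.toLinearMap = G.g p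
  trans : G.Transitive
  e_stable : ∀ x ∈ G.g 0, ∀ y ∈ e, ⁅x, ι y⁆ ∈ e.map ι.toLinearMap
  f_stable : ∀ x ∈ G.g 0, ∀ y ∈ f, ⁅x, ι y⁆ ∈ f.map ι.toLinearMap

theorem IsPPFGLA.symm {L : Type} [LieRing L] [LieAlgebra ℂ L] {G : GLA L} {e f : Submodule ℂ L}
    (h : IsPPFGLA G e f) : IsPPFGLA G f e :=
  ⟨h.fgla, h.f_ne_bot, h.e_ne_bot, sup_comm e f ▸ h.sup_eq, inf_comm e f ▸ h.inf_eq,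
    h.lie_ff, h.lie_ee⟩

theorem IsFreePPFGLA.symm {L : Type} [LieRing L] [LieAlgebra ℂ L] {G : GLA L}
    {e f : Submodule ℂ L} {m n μ : ℕ} (h : IsFreePPFGLA G e f m n μ) :
    IsFreePPFGLA G f e n m μ :=
  ⟨h.1.symm, h.2.1, h.2.2.2.1, h.2.2.1, fun L' _ _ G' e' f' hG' hk φ hφ he hf =>
    h.2.2.2.2 L' G' f' e' hG'.symm hk φ hφ hf he⟩

theorem IsPPFGLA.left_le {L : Type} [LieRing L] [LieAlgebra ℂ L] {G : GLA L}
    {e f : Submodule ℂ L} (h : IsPPFGLA G e f) : e ≤ G.g (-1) := h.sup_eq ▸ le_sup_left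

theorem IsPPFGLA.right_le {L : Type} [LieRing L] [LieAlgebra ℂ L] {G : GLA L}
    {e f : Submodule ℂ L} (h : IsPPFGLA G e f) : f ≤ G.g (-1) := h.sup_eq ▸ le_sup_right

theorem IsPPFGLA.exists_dual {L : Type} [LieRing L] [LieAlgebra ℂ L] {G : GLA L}
    {e f : Submodule ℂ L} (h : IsPPFGLA G e f) {x : L} (hx : x ∈ e) (hx0 : x ≠ 0) :
    ∃ ξ : Module.Dual ℂ L, (∀ y ∈ f, ξ y = 0) ∧ ξ x = 1 := by
  have hxf : x ∉ f := fun hxf => hx0 <| by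
    have : x ∈ e ⊓ f := ⟨hx, hxf⟩
    rwa [h.inf_eq, Submodule.mem_bot] at this
  obtain ⟨ξ, hξx, hξ⟩ := Submodule.exists_le_ker_of_notMem hxf
  refine ⟨(ξ x)⁻¹ • ξ, fun y hy => ?_, ?_⟩
  · simp [LinearMap.mem_ker.1 (hξ hy)]
  · simp [hξx]

/-- An element of `e` killed by all normalized functionals vanishing on `f` is zero. -/
theorem IsPPFGLA.eq_zero_of_dual {L : Type} [LieRing L] [LieAlgebra ℂ L] {G : GLA L}
    {e f : Submodule ℂ L} (h : IsPPFGLA G e f) {x c : L} (hx : x ∈ e) (hx0 : x ≠ 0) (hc : c ∈ e)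
    (H : ∀ ξ : Module.Dual ℂ L, (∀ y ∈ f, ξ y = 0) → ξ x = 1 → ξ c = 0) : c = 0 := by
  by_contra hc0
  obtain ⟨ξ, hξ, hξx⟩ := h.exists_dual hx hx0
  obtain ⟨ζ, hζ, hζc⟩ := h.exists_dual hc hc0
  have h1 := H ξ hξ hξx
  have h2 := H (ζ + (1 - ζ x) • ξ) (fun y hy => by simp [hξ y hy, hζ y hy]) (by simp [hξx])
  simp [h1, hζc] at h2

section Extension

variable {Lm LG : Type} [LieRing Lm] [LieAlgebra ℂ Lm] [LieRing LG] [LieAlgebra ℂ LG]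
  {M : GLA Lm} {e f : Submodule ℂ Lm} {G : GLA LG} {ι : Lm →ₗ⁅ℂ⁆ LG}

theorem IsPPExtension.symm (h : IsPPExtension M e f G ι) : IsPPExtension M f e G ι :=
  ⟨h.inj, h.graded_neg, h.trans, h.f_stable, h.e_stable⟩

theorem IsPPExtension.map_mem (h : IsPPExtension M e f G ι) {p : ℤ} (hp : p < 0) {z : Lm}
    (hz : z ∈ M.g p) : ι z ∈ G.g p :=
  h.graded_neg p hp ▸ Submodule.mem_map_of_mem (f := ι.toLinearMap) hz

theorem IsPPExtension.eq_zero (h : IsPPExtension M e f G ι) (hpp : IsPPFGLA M e f) {p : ℤ}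
    (hp : 0 ≤ p) {X : LG} (hX : X ∈ G.g p) (he : ∀ x ∈ e, ⁅X, ι x⁆ = 0)
    (hf : ∀ y ∈ f, ⁅X, ι y⁆ = 0) : X = 0 := by
  have h1 : ∀ z ∈ M.g (-1), ⁅X, ι z⁆ = 0 := by
    intro z hz
    rw [← hpp.sup_eq] at hz
    obtain ⟨x, hx, y, hy, rfl⟩ := Submodule.mem_sup.1 hz
    rw [map_add, lie_add, he x hx, hf y hy, add_zero]
  have h2 : ∀ k : ℕ, ∀ z ∈ M.g (-(k + 1 : ℤ)), ⁅X, ι z⁆ = 0 := by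
    intro k
    induction k with
    | zero => simpa using h1
    | succ k ih =>
      intro z hz
      rw [show (-(((k + 1 : ℕ) : ℤ) + 1)) = -(k + 1 : ℤ) - 1 by push_cast; ring,
        hpp.fgla.generated _ (by omega)] at hz
      refine Submodule.span_induction ?_ (by simp) (fun a b _ _ ha hb => by
        rw [map_add, lie_add, ha, hb, add_zero]) (fun c a _ ha => by
        rw [map_smul, lie_smul, ha, smul_zero]) hz
      rintro _ ⟨a, ha, b, hb, rfl⟩
      rw [LieHom.map_lie, leibniz_lie, ih a ha, h1 b hb]
      simp
  refine h.trans p hp X hX fun q hq y hy => ?_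
  rw [← h.graded_neg q hq] at hy
  obtain ⟨z, hz, rfl⟩ := hy
  obtain ⟨k, rfl⟩ : ∃ k : ℕ, q = -(k + 1 : ℤ) := ⟨(-q - 1).toNat, by omega⟩
  exact h2 k z hz

theorem iterate_lie_mem (hpp : IsPPFGLA M e f) {x y : Lm} (hx : x ∈ e) (hy : y ∈ f) (k : ℕ) :
    (fun z => ⁅x, z⁆)^[k] y ∈ M.g (-(k + 1 : ℤ)) := by
  induction k with
  | zero => simpa using hpp.right_le hy
  | succ k ih =>
    rw [Function.iterate_succ_apply']
    have := M.bracket_mem _ _ x (hpp.left_le hx) _ ih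
    convert this using 2
    push_cast; ring

variable {μ : ℕ} {Φ : Lm →ₗ⁅ℂ⁆ Filiform μ} {ξ η : Module.Dual ℂ Lm}

theorem map_iterate_lie (hΦe : ∀ z ∈ e, Φ z = ξ z • Filiform.a)
    (hΦf : ∀ z ∈ f, Φ z = η z • Filiform.v 0) {x y : Lm} (hx : x ∈ e) (hy : y ∈ f)
    (hξx : ξ x = 1) (k : ℕ) : Φ ((fun z => ⁅x, z⁆)^[k] y) = η y • Filiform.v k := by
  induction k with
  | zero => exact hΦf y hy
  | succ k ih =>
    rw [Function.iterate_succ_apply', LieHom.map_lie, ih, hΦe x hx, hξx]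
    simp

/-- The action of a degree-0 element on `⁅x, …, ⁅x, y⁆⁆`, seen in the filiform quotient. -/
theorem exists_zero_action (hΦe : ∀ z ∈ e, Φ z = ξ z • Filiform.a)
    (hΦf : ∀ z ∈ f, Φ z = η z • Filiform.v 0) {x y a b : Lm} (hx : x ∈ e) (hy : y ∈ f)
    (ha : a ∈ e) (hb : b ∈ f) (hξx : ξ x = 1) {T : LG} (hTx : ⁅T, ι x⁆ = ι a)
    (hTy : ⁅T, ι y⁆ = ι b) (k : ℕ) :
    ∃ s, ⁅T, ι ((fun z => ⁅x, z⁆)^[k] y)⁆ = ι s ∧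
      Φ s = (k * (ξ a * η y) + η b) • Filiform.v k := by
  induction k with
  | zero => exact ⟨b, hTy, by simp [hΦf b hb]⟩
  | succ k ih =>
    obtain ⟨s, hs, hΦs⟩ := ih
    refine ⟨⁅a, (fun z => ⁅x, z⁆)^[k] y⁆ + ⁅x, s⁆, ?_, ?_⟩
    · rw [Function.iterate_succ_apply', LieHom.map_lie, leibniz_lie, hTx, hs, map_add,
        LieHom.map_lie, LieHom.map_lie]
    · rw [map_add, LieHom.map_lie, LieHom.map_lie, hΦs, map_iterate_lie hΦe hΦf hx hy hξx,
        hΦe x hx, hΦe a ha, hξx]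
      simp only [lie_smul, smul_lie, Filiform.lie_a_v, one_smul, smul_smul, ← add_smul]
      congr 1
      push_cast; ring

/-- The action of a degree-1 element on `⁅x, …, ⁅x, y⁆⁆`, seen in the filiform quotient. -/
theorem exists_one_action (hΦe : ∀ z ∈ e, Φ z = ξ z • Filiform.a)
    (hΦf : ∀ z ∈ f, Φ z = η z • Filiform.v 0) {x y a b c : Lm} (hx : x ∈ e) (hy : y ∈ f)
    (ha : a ∈ e) (hb : b ∈ f) (hc : c ∈ e) (hξx : ξ x = 1) {X : LG}
    (hTx : ⁅⁅X, ι x⁆, ι x⁆ = ι a)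
    (hTy : ⁅⁅X, ι x⁆, ι y⁆ = ι b) (hUx : ⁅⁅X, ι y⁆, ι x⁆ = ι c) (k : ℕ) :
    ∃ s, ⁅X, ι ((fun z => ⁅x, z⁆)^[k + 2] y)⁆ = ι s ∧
      Φ s = ((k + 2) * (k + 1) / 2 * (ξ a * η y) + (k + 2) * η b) • Filiform.v (k + 1) := by
  induction k with
  | zero =>
    obtain ⟨s, hs, hΦs⟩ := exists_zero_action hΦe hΦf hx hy ha hb hξx hTx hTy 1
    have hxy : ⁅X, ι ⁅x, y⁆⁆ = ι (b - c) := by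
      rw [LieHom.map_lie, leibniz_lie X, hTy, ← lie_skew, hUx, map_sub, sub_eq_add_neg]
    refine ⟨s + ⁅x, b - c⁆, ?_, ?_⟩
    · rw [Function.iterate_succ_apply', LieHom.map_lie, leibniz_lie, hs,
        Function.iterate_one, hxy, map_add, LieHom.map_lie]
    · rw [map_add, hΦs, LieHom.map_lie, map_sub, hΦe x hx, hΦf b hb, hΦe c hc, hξx]
      simp only [lie_smul, one_smul, lie_sub, Filiform.lie_a_v, lie_self, smul_zero, sub_zero,
        ← add_smul]
      congr 1
      push_cast; ring
  | succ k ih =>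
    obtain ⟨r, hr, hΦr⟩ := ih
    obtain ⟨s, hs, hΦs⟩ := exists_zero_action hΦe hΦf hx hy ha hb hξx hTx hTy (k + 2)
    refine ⟨s + ⁅x, r⁆, ?_, ?_⟩
    · rw [show k + 1 + 2 = (k + 2) + 1 by ring, Function.iterate_succ_apply', LieHom.map_lie,
        leibniz_lie, hs, hr, map_add, LieHom.map_lie]
    · rw [map_add, hΦs, LieHom.map_lie, hΦe x hx, hξx, hΦr]
      simp only [lie_smul, one_smul, Filiform.lie_a_v, ← add_smul]
      congr 1
      push_cast; ring

theorem IsPPExtension.lie_mem_zero (h : IsPPExtension M e f G ι) {X : LG} (hX : X ∈ G.g 1)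
    {z : Lm} (hz : z ∈ M.g (-1)) : ⁅X, ι z⁆ ∈ G.g 0 := by
  simpa using G.bracket_mem 1 (-1) X hX _ (h.map_mem (by norm_num) hz)

/-- The relation imposed on a degree-1 element by the vanishing of `(ad x)^μ y`. -/
theorem IsPPExtension.top_relation {m n : ℕ} (h : IsPPExtension M e f G ι)
    (hfree : IsFreePPFGLA M e f m n μ) (hμ : 2 ≤ μ) {X : LG} (hX : X ∈ G.g 1)
    {x y a b : Lm} (hx : x ∈ e) (hy : y ∈ f) (ha : a ∈ e) (hb : b ∈ f)
    (hTx : ⁅⁅X, ι x⁆, ι x⁆ = ι a) (hTy : ⁅⁅X, ι x⁆, ι y⁆ = ι b)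
    (hξ : ∀ y ∈ f, ξ y = 0) (hη : ∀ x ∈ e, η x = 0) (hξx : ξ x = 1) (hηy : η y = 1) :
    ((μ : ℂ) - 1) * ξ a + 2 * η b = 0 := by
  have hpp := hfree.1
  obtain ⟨Φ, hΦe, hΦf⟩ := hfree.exists_hom_filiform (by omega) ξ η hξ hη hx hy hξx hηy
  obtain ⟨c, hc, hUx⟩ := h.e_stable _ (h.lie_mem_zero hX (hpp.right_le hy)) x hx
  obtain ⟨k, rfl⟩ : ∃ k, μ = k + 2 := ⟨μ - 2, by omega⟩
  obtain ⟨s, hs, hΦs⟩ := exists_one_action hΦe hΦf hx hy ha hb hc hξx hTx hTy hUx.symm k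
  have h0 := iterate_lie_mem hpp hx hy (k + 2)
  rw [hfree.2.1.2 _ (by omega), Submodule.mem_bot] at h0
  rw [h0, map_zero, lie_zero] at hs
  rw [(map_eq_zero_iff ι h.inj).1 hs.symm, map_zero, hηy, mul_one, eq_comm,
    smul_eq_zero, or_iff_left (Filiform.v_ne_zero (by omega))] at hΦs
  have h2 : (k + 2 : ℂ) ≠ 0 := by exact_mod_cast (by omega : k + 2 ≠ 0)
  apply mul_left_cancel₀ h2
  push_cast
  linear_combination 2 * hΦs

/-- In depth at least three, `⁅X, ι y⁆` annihilates `x` and `y`. -/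
theorem IsPPExtension.lie_lie_eq_zero {m n : ℕ} (h : IsPPExtension M e f G ι)
    (hfree : IsFreePPFGLA M e f m n μ) (hμ : 3 ≤ μ) {X : LG} (hX : X ∈ G.g 1)
    {x y : Lm} (hx : x ∈ e) (hy : y ∈ f) (hx0 : x ≠ 0) (hy0 : y ≠ 0) :
    ⁅⁅X, ι y⁆, ι x⁆ = 0 ∧ ⁅⁅X, ι y⁆, ι y⁆ = 0 := by
  have hpp := hfree.1
  have hT := h.lie_mem_zero hX (hpp.left_le hx)
  have hU := h.lie_mem_zero hX (hpp.right_le hy)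
  obtain ⟨a, ha, hTx⟩ := h.e_stable _ hT x hx
  obtain ⟨b, hb, hTy⟩ := h.f_stable _ hT y hy
  obtain ⟨c, hc, hUx⟩ := h.e_stable _ hU x hx
  obtain ⟨d, hd, hUy⟩ := h.f_stable _ hU y hy
  have key : ∀ ξ η : Module.Dual ℂ Lm, (∀ y ∈ f, ξ y = 0) → (∀ x ∈ e, η x = 0) → ξ x = 1 →
      η y = 1 → ξ c = 0 ∧ η d = 0 := by
    intro ξ η hξ hη hξx hηy
    obtain ⟨Φ, hΦe, hΦf⟩ := hfree.exists_hom_filiform (by omega) ξ η hξ hη hx hy hξx hηy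
    have r1 := h.symm.top_relation hfree.symm (by omega) hX hy hx hd hc hUy.symm hUx.symm
      hη hξ hηy hξx
    obtain ⟨k, rfl⟩ : ∃ k, μ = k + 3 := ⟨μ - 3, by omega⟩
    obtain ⟨s, hs, hΦs⟩ := exists_one_action hΦe hΦf hx hy ha hb hc hξx hTx.symm hTy.symm
      hUx.symm k
    obtain ⟨t, ht, hΦt⟩ := exists_zero_action hΦe hΦf hx hy hc hd hξx hUx.symm hUy.symm (k + 2)
    have h0 := M.bracket_mem _ _ y (hpp.right_le hy) _ (iterate_lie_mem hpp hx hy (k + 2))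
    rw [hfree.2.1.2 _ (by push_cast; omega), Submodule.mem_bot] at h0
    have h1 : ι (t + ⁅y, s⁆) = 0 := by
      rw [map_add, LieHom.map_lie, ← ht, ← hs, ← leibniz_lie, ← LieHom.map_lie, h0, map_zero,
        lie_zero]
    have h2 := congrArg Φ ((map_eq_zero_iff ι h.inj).1 h1)
    rw [map_add, LieHom.map_lie, hΦt, hΦs, hΦf y hy, map_zero, smul_lie, lie_smul,
      Filiform.lie_v_v, smul_zero, smul_zero, add_zero, hηy, mul_one,
      smul_eq_zero, or_iff_left (Filiform.v_ne_zero (by omega))] at h2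
    push_cast at h2 r1
    have h3 : (k * k + 4 * k + 2 : ℂ) ≠ 0 := by
      exact_mod_cast (by positivity : k * k + 4 * k + 2 ≠ 0)
    have h4 : ξ c = 0 := by
      apply mul_left_cancel₀ h3
      linear_combination (k + 2) * h2 - r1
    refine ⟨h4, ?_⟩
    rw [h4] at h2
    simpa using h2
  constructor
  · obtain ⟨η, hη, hηy⟩ := hpp.symm.exists_dual hy hy0
    rw [← hUx, hpp.eq_zero_of_dual hx hx0 hc fun ξ hξ hξx => (key ξ η hξ hη hξx hηy).1, map_zero]
  · obtain ⟨ξ, hξ, hξx⟩ := hpp.exists_dual hx hx0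
    rw [← hUy, hpp.symm.eq_zero_of_dual hy hy0 hd fun η hη hηy => (key ξ η hξ hη hξx hηy).2,
      map_zero]

theorem IsPPExtension.lie_right_eq_zero {m n : ℕ} (h : IsPPExtension M e f G ι)
    (hfree : IsFreePPFGLA M e f m n μ) (hμ : 3 ≤ μ) {X : LG} (hX : X ∈ G.g 1)
    {y : Lm} (hy : y ∈ f) : ⁅X, ι y⁆ = 0 := by
  have hpp := hfree.1
  obtain ⟨x₀, hx₀, hx₀0⟩ := Submodule.exists_mem_ne_zero_of_ne_bot hpp.e_ne_bot
  have hself : ∀ y ∈ f, ⁅⁅X, ι y⁆, ι y⁆ = 0 := by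
    intro y hy
    by_cases hy0 : y = 0
    · simp [hy0]
    · exact (h.lie_lie_eq_zero hfree hμ hX hx₀ hy hx₀0 hy0).2
  refine h.eq_zero hpp le_rfl (h.lie_mem_zero hX (hpp.right_le hy)) (fun x hx => ?_)
    fun z hz => ?_
  · by_cases hx0 : x = 0
    · simp [hx0]
    by_cases hy0 : y = 0
    · simp [hy0]
    exact (h.lie_lie_eq_zero hfree hμ hX hx hy hx0 hy0).1
  · have h1 := hself (y + z) (add_mem hy hz)
    simp only [map_add, lie_add, add_lie, hself y hy, hself z hz] at h1
    have h2 : ⁅X, ι ⁅y, z⁆⁆ = 0 := by rw [hpp.lie_ff y hy z hz, map_zero, lie_zero]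
    rw [LieHom.map_lie, leibniz_lie, ← lie_skew (ι y)] at h2
    have h3 : (2 : ℂ) • ⁅⁅X, ι y⁆, ι z⁆ = 0 := by
      simp only [zero_add, add_zero] at h1
      calc (2 : ℂ) • ⁅⁅X, ι y⁆, ι z⁆ = (⁅⁅X, ι z⁆, ι y⁆ + ⁅⁅X, ι y⁆, ι z⁆) +
          (⁅⁅X, ι y⁆, ι z⁆ + -⁅⁅X, ι z⁆, ι y⁆) := by rw [two_smul]; abel
        _ = 0 := by rw [h1, h2, add_zero]
    simpa using h3

/-- The first prolongation of a free pseudo-product FGLA of depth at least three vanishes. -/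
theorem IsPPExtension.g_one_eq_bot {m n : ℕ} (h : IsPPExtension M e f G ι)
    (hfree : IsFreePPFGLA M e f m n μ) (hμ : 3 ≤ μ) : G.g 1 = ⊥ :=
  (Submodule.eq_bot_iff _).2 fun _ hX => h.eq_zero hfree.1 zero_le_one hX
    (fun _ hx => h.symm.lie_right_eq_zero hfree.symm hμ hX hx)
    fun _ hy => h.lie_right_eq_zero hfree hμ hX hy

end Extension

namespace SlGraded

open LieAlgebra.SpecialLinear

variable {κ : Type} [Fintype κ] [DecidableEq κ]

theorem ext_entry {A B : sl κ ℂ} (h : ∀ a b, A.1 a b = B.1 a b) : A = B :=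
  Subtype.ext (Matrix.ext h)

@[simp] theorem add_entry (A B : sl κ ℂ) (a b : κ) : (A + B).1 a b = A.1 a b + B.1 a b := rfl
@[simp] theorem sub_entry (A B : sl κ ℂ) (a b : κ) : (A - B).1 a b = A.1 a b - B.1 a b := rfl
@[simp] theorem neg_entry (A : sl κ ℂ) (a b : κ) : (-A).1 a b = -A.1 a b := rfl
@[simp] theorem zero_entry (a b : κ) : (0 : sl κ ℂ).1 a b = 0 := rfl
@[simp] theorem smul_entry (s : ℂ) (A : sl κ ℂ) (a b : κ) : (s • A).1 a b = s * A.1 a b := rfl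

theorem lie_entry (A B : sl κ ℂ) (a b : κ) :
    ⁅A, B⁆.1 a b = ∑ k, A.1 a k * B.1 k b - ∑ k, B.1 a k * A.1 k b := rfl

theorem sum_diag (A : sl κ ℂ) : ∑ a, A.1 a a = 0 := A.2

/-- The elementary matrix with entry `1` at `(i, j)`, or zero if `i = j`. -/
def elem (i j : κ) : sl κ ℂ := if h : i = j then 0 else single i j h 1

theorem elem_entry {i j : κ} (h : i ≠ j) (a b : κ) :
    (elem i j).1 a b = if a = i ∧ b = j then 1 else 0 := by
  rw [elem, dif_neg h, val_single, Matrix.single_apply]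
  simp [eq_comm]

theorem lie_elem_entry (A : sl κ ℂ) {i j : κ} (h : i ≠ j) (a b : κ) :
    ⁅A, elem i j⁆.1 a b = (if b = j then A.1 a i else 0) - (if a = i then A.1 j b else 0) := by
  rw [lie_entry]
  simp only [elem_entry h]
  congr 1
  · by_cases hb : b = j <;> simp [hb]
  · by_cases ha : a = i <;> simp [ha]

theorem elem_lie_entry (A : sl κ ℂ) {i j : κ} (h : i ≠ j) (a b : κ) :
    ⁅elem i j, A⁆.1 a b = (if a = i then A.1 j b else 0) - (if b = j then A.1 a i else 0) := by
  rw [← lie_skew, neg_entry, lie_elem_entry A h]; ring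

theorem lie_elem_elem {i j k : κ} (hij : i ≠ j) (hjk : j ≠ k) (hik : i ≠ k) :
    ⁅(elem i j : sl κ ℂ), elem j k⁆ = elem i k := by
  refine ext_entry fun a b => ?_
  rw [lie_elem_entry _ hjk, elem_entry hij, elem_entry hij, elem_entry hik]
  split_ifs <;> grind

/-- The diagonal matrix with entries `1` at `i` and `-1` at `j`. -/
def diagSub (i j : κ) : sl κ ℂ := singleSubSingle i j 1

theorem diagSub_entry (i j a b : κ) : (diagSub i j).1 a b =
    (if a = i ∧ b = i then 1 else 0) - (if a = j ∧ b = j then 1 else 0) := by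
  rw [diagSub, val_singleSubSingle, Matrix.sub_apply, Matrix.single_apply, Matrix.single_apply]
  simp [eq_comm]

theorem lie_elem_elem_self {i j : κ} (hij : i ≠ j) :
    ⁅(elem i j : sl κ ℂ), elem j i⁆ = diagSub i j := by
  refine ext_entry fun a b => ?_
  rw [lie_elem_entry _ hij.symm, elem_entry hij, elem_entry hij, diagSub_entry]
  grind

theorem lie_diagSub_elem (i j : κ) {k l : κ} (h : k ≠ l) :
    ⁅(diagSub i j : sl κ ℂ), elem k l⁆ =
      (((if k = i then 1 else 0) - (if k = j then 1 else 0) - (if l = i then 1 else 0) +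
        (if l = j then 1 else 0) : ℤ) : ℂ) • elem k l := by
  refine ext_entry fun a b => ?_
  rw [lie_elem_entry _ h, smul_entry, elem_entry h, diagSub_entry, diagSub_entry]
  push_cast
  grind

theorem eq_top_of_mem [Nonempty κ] (S : Submodule ℂ (sl κ ℂ))
    (h1 : ∀ i j : κ, i ≠ j → elem i j ∈ S) (h2 : ∀ i j : κ, i ≠ j → diagSub i j ∈ S) : S = ⊤ := by
  rw [eq_top_iff]
  intro A _
  obtain ⟨o⟩ := ‹Nonempty κ›
  have hA : A = ∑ i, ∑ j, A.1 i j • (if i = j then diagSub i o else elem i j) := by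
    refine Subtype.ext ?_
    have e : ∀ i j, ((A.1 i j • (if i = j then diagSub i o else elem i j) : sl κ ℂ) :
        Matrix κ κ ℂ) = Matrix.single i j (A.1 i j) -
          if i = j then Matrix.single o o (A.1 i j) else 0 := by
      intro i j
      ext a b
      by_cases h : i = j
      · subst h
        simp only [if_true]
        rw [smul_entry, diagSub_entry, Matrix.sub_apply, Matrix.single_apply, Matrix.single_apply]
        grind
      · simp only [if_neg h]
        rw [smul_entry, elem_entry h, Matrix.sub_apply, Matrix.single_apply]
        simp only [Matrix.zero_apply]
        grind
    rw [AddSubmonoidClass.coe_finsetSum]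
    simp_rw [AddSubmonoidClass.coe_finsetSum, e, Finset.sum_sub_distrib, Finset.sum_ite_eq,
      Finset.mem_univ, if_true]
    rw [← Matrix.matrix_eq_sum_single]
    have : ∑ i, Matrix.single o o (A.1 i i) = Matrix.single o o (∑ i, A.1 i i) :=
      (map_sum (Matrix.singleLinearMap ℂ o o) (fun i => A.1 i i) _).symm
    rw [this, sum_diag, Matrix.single_zero, sub_zero]
  rw [hA]
  refine sum_mem fun i _ => sum_mem fun j _ => Submodule.smul_mem _ _ ?_
  split_ifs with h
  · by_cases ho : i = o
    · have : diagSub i o = (0 : sl κ ℂ) := ext_entry fun a b => by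
        rw [diagSub_entry, ho]; simp
      rw [this]; exact zero_mem _
    · exact h2 i o ho
  · exact h1 i j h

variable (d : κ → ℤ)

/-- Matrices supported on the entries `(a, b)` with `d a - d b = p`. -/
def grade (p : ℤ) : Submodule ℂ (sl κ ℂ) where
  carrier := {A | ∀ a b, d a - d b ≠ p → A.1 a b = 0}
  add_mem' := fun hx hy a b h => by simp [hx a b h, hy a b h]
  zero_mem' := fun _ _ _ => rfl
  smul_mem' := fun c x hx a b h => by simp [hx a b h]

variable {d}

theorem mem_grade {p : ℤ} {A : sl κ ℂ} :
    A ∈ grade d p ↔ ∀ a b, d a - d b ≠ p → A.1 a b = 0 := Iff.rfl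

theorem elem_mem (i j : κ) : (elem i j : sl κ ℂ) ∈ grade d (d i - d j) := by
  by_cases h : i = j
  · rw [elem, dif_pos h]; exact zero_mem _
  · intro a b hab
    rw [elem_entry h]
    grind

theorem diagSub_mem (i j : κ) : (diagSub i j : sl κ ℂ) ∈ grade d 0 := by
  intro a b hab
  rw [diagSub_entry]
  grind

variable (d)

/-- The degree derivation `A a b ↦ (d a - d b) A a b`. -/
def degree : Module.End ℂ (sl κ ℂ) where
  toFun A := ⟨Matrix.of fun a b => ((d a - d b : ℤ) : ℂ) * A.1 a b, by
    change ∑ a, _ = _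
    simp⟩
  map_add' A B := ext_entry fun a b => by
    change ((d a - d b : ℤ) : ℂ) * (A + B).1 a b =
      ((d a - d b : ℤ) : ℂ) * A.1 a b + ((d a - d b : ℤ) : ℂ) * B.1 a b
    rw [add_entry]; ring
  map_smul' s A := ext_entry fun a b => by
    change ((d a - d b : ℤ) : ℂ) * (s • A).1 a b = s * (((d a - d b : ℤ) : ℂ) * A.1 a b)
    rw [smul_entry]; ring

theorem degree_entry (A : sl κ ℂ) (a b : κ) :
    (degree d A).1 a b = ((d a - d b : ℤ) : ℂ) * A.1 a b := rfl

/-- The grading of `sl` defined by a degree function on the index set. -/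
def gla [Nonempty κ] : GLA (sl κ ℂ) where
  g := grade d
  internal := by
    refine isInternal_of_le_eigenspace (degree d) _ (fun p A hA => ?_)
      (eq_top_of_mem _ (fun i j _ => Submodule.mem_iSup_of_mem _ (elem_mem i j))
        (fun i j _ => Submodule.mem_iSup_of_mem _ (diagSub_mem i j)))
    rw [Module.End.mem_eigenspace_iff]
    refine ext_entry fun a b => ?_
    rw [degree_entry, smul_entry]
    by_cases h : d a - d b = p
    · rw [h]
    · rw [hA a b h]; simp
  bracket_mem p q A hA B hB a b h := by
    rw [lie_entry, Finset.sum_eq_zero, Finset.sum_eq_zero, sub_zero]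
    · intro k _
      by_cases h1 : d a - d k = q
      · rw [hA k b (by omega), mul_zero]
      · rw [hB a k h1, zero_mul]
    · intro k _
      by_cases h1 : d a - d k = p
      · rw [hB k b (by omega), mul_zero]
      · rw [hA a k h1, zero_mul]
  findim p := inferInstance

/-- The matrix elements of the cocycle relation for `(V_i, V_k, W_j)`. -/
def CocycleRel (c : κ) (A B : κ → Matrix κ κ ℂ) (i k j : κ) : Prop :=
  ∀ a b, -((if b = k then A i a j else 0) - (if a = j then A i k b else 0))
    + (if a = c then ((if b = c then A k i j else 0) - (if i = j then A k c b else 0)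
        + (if i = c then B j k b else 0) - (if b = k then B j i c else 0)) else 0)
    - (if b = i then (A k a j - (if a = j then A k c c else 0) + (if a = c then B j k c else 0)
        - (if c = k then B j a c else 0)) else 0) = 0

variable {d} {c : κ}

theorem cocycle_degree_zero (hc : ∀ a, d a = 0 ↔ a = c) (hd : ∀ a, d a = 1 ∨ d a = 0 ∨ d a = -1)
    {A B : κ → Matrix κ κ ℂ} (hA : ∀ i, d i = 1 → ∀ a b, d a - d b ≠ 0 → A i a b = 0)
    (htr : ∀ i, d i = 1 → ∑ a, A i a a = 0)
    (H : ∀ i k j, d i = 1 → d k = 1 → d j = -1 → CocycleRel c A B i k j)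
    {o : κ} (ho : d o = -1) {i : κ} (hi : d i = 1) (a b : κ) :
    A i a b = if b = i ∧ d a = 1 then -A a c c else if a = c ∧ b = c then A i c c else 0 := by
  have hdc : d c = 0 := (hc c).2 rfl
  have rel : ∀ i k j a b, d i = 1 → d k = 1 → d j = -1 → d a = -1 → d b = 1 →
      -((if b = k then A i a j else 0) - (if a = j then A i k b else 0))
      - (if b = i then (A k a j - (if a = j then A k c c else 0)) else 0) = 0 := by
    intro i k j a b hi hk hj ha hb
    have hac : a ≠ c := fun h => by rw [h] at ha; omega
    have hck : c ≠ k := fun h => by rw [← h] at hk; omega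
    simpa [hac, hck] using H i k j hi hk hj a b
  have offdiag : ∀ i, d i = 1 → ∀ a j, d a = -1 → d j = -1 → a ≠ j → A i a j = 0 := by
    intro i hi a j ha hj haj
    have := rel i i j a i hi hi hj ha hi
    simp only [if_true, if_neg haj] at this
    linear_combination (-1 / 2) * this
  have h1 : ∀ i k j b, d i = 1 → d k = 1 → d j = -1 → d b = 1 →
      A i k b = (if b = k then A i j j else 0) + if b = i then A k j j - A k c c else 0 := by
    intro i k j b hi hk hj hb
    have := rel i k j j b hi hk hj hj hb
    simp only [if_true] at this
    linear_combination this
  have h2 : ∀ i, d i = 1 → ∀ j, d j = -1 → A i j j = A i o o := by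
    intro i hi j hj
    have e1 := h1 i i j i hi hi hj hi
    have e2 := h1 i i o i hi hi ho hi
    simp only [if_true] at e1 e2
    linear_combination (e2 - e1) / 2
  have h3 : ∀ i, d i = 1 → A i o o = 0 := by
    intro i hi
    have hic : i ≠ c := fun h => by rw [h] at hi; omega
    have e : ∀ a, A i a a = A i o o + (if a = i then A i o o - A i c c else 0) +
        if a = c then A i c c - A i o o else 0 := by
      intro a
      rcases hd a with ha | ha | ha
      · have hac : a ≠ c := fun h => by rw [h] at ha; omega
        rw [h1 i a o a hi ha ho ha]
        by_cases hai : a = i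
        · simp [hai, hic]
        · simp [hai, hac]
      · have hac := (hc a).1 ha
        subst hac
        simp [hic.symm]
      · have hac : a ≠ c := fun h => by rw [h] at ha; omega
        have hai : a ≠ i := fun h => by rw [h] at ha; omega
        simp [hac, hai, h2 i hi a ha]
    have ht := htr i hi
    rw [Finset.sum_congr rfl fun a _ => e a] at ht
    simp only [Finset.sum_add_distrib, Finset.sum_const, Finset.sum_ite_eq', Finset.mem_univ,
      if_true, nsmul_eq_mul, Finset.card_univ] at ht
    have hN : (Fintype.card κ : ℂ) ≠ 0 := by
      have : Nonempty κ := ⟨c⟩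
      exact_mod_cast Fintype.card_ne_zero
    apply mul_left_cancel₀ hN
    linear_combination ht
  by_cases hab : d a - d b = 0
  · rcases hd a with ha | ha | ha
    · have hb : d b = 1 := by omega
      have hac : a ≠ c := fun h => by rw [h] at ha; omega
      rw [h1 i a o b hi ha ho hb, h3 i hi, h3 a ha]
      simp [ha, hac]
    · have hac := (hc a).1 ha
      have hbc := (hc b).1 (by omega)
      subst hac; subst hbc
      have hib : b ≠ i := fun h => by rw [h] at ha; omega
      simp [hib]
    · have hb : d b = -1 := by omega
      have hac : a ≠ c := fun h => by rw [h] at ha; omega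
      have hbi : b ≠ i := fun h => by rw [h] at hb; omega
      simp only [hbi, hac, false_and, if_false]
      by_cases h : a = b
      · subst h; rw [h2 i hi a ha, h3 i hi]
      · exact offdiag i hi a b ha hb h
  · rw [hA i hi a b hab]
    have h1 : ¬ (b = i ∧ d a = 1) := fun h => hab (by rw [h.1, h.2, hi]; rfl)
    have h2 : ¬ (a = c ∧ b = c) := fun h => hab (by rw [h.1, h.2]; ring)
    rw [if_neg h1, if_neg h2]

omit [Fintype κ] in
theorem cocycle_degree_one (hc : ∀ a, d a = 0 ↔ a = c) (hd : ∀ a, d a = 1 ∨ d a = 0 ∨ d a = -1)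
    {A B : κ → Matrix κ κ ℂ} (hA : ∀ i, d i = 1 → ∀ a b, d a - d b ≠ 1 → A i a b = 0)
    (H : ∀ i k j, d i = 1 → d k = 1 → d j = -1 → CocycleRel c A B i k j)
    {o : κ} (ho : d o = -1) {i : κ} (hi : d i = 1) :
    (∀ a b, ¬ (a = c ∧ d b = -1) → A i a b = 0) ∧ ∀ j, d j = -1 → A i c j = -B j i c := by
  have hdc : d c = 0 := (hc c).2 rfl
  have ne1 : ∀ i, d i = 1 → i ≠ c := fun i hi h => by rw [h] at hi; omega
  have ne2 : ∀ i, d i = -1 → i ≠ c := fun i hi h => by rw [h] at hi; omega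
  have h1 : ∀ k, d k = 1 → A i k c = 0 := by
    intro k hk
    have := H i k o hi hk ho o c
    have hok : o ≠ k := fun h => by rw [h] at ho; omega
    simpa [(ne1 k hk).symm, (ne1 i hi).symm, ne2 o ho] using this
  constructor
  · intro a b hab
    by_cases h : d a - d b = 1
    · by_cases ha : a = c
      · exact absurd ⟨ha, by rw [ha] at h; omega⟩ hab
      · by_cases hb : b = c
        · subst hb; exact h1 a (by omega)
        · have := mt (hc a).1 ha
          have := mt (hc b).1 hb
          have := hd a
          have := hd b
          omega
    · exact hA i hi a b h
  · intro j hj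
    have hij : i ≠ j := fun h => by rw [h] at hi; omega
    have := H i i j hi hi hj c i
    simp only [if_true, if_neg (ne1 i hi), if_neg hij, if_neg (ne2 j hj).symm,
      if_neg (ne1 i hi).symm] at this
    linear_combination (-1 / 2) * this

omit [Fintype κ] in
theorem cocycle_degree_two (hc : ∀ a, d a = 0 ↔ a = c) (hd : ∀ a, d a = 1 ∨ d a = 0 ∨ d a = -1)
    {A B : κ → Matrix κ κ ℂ} {q : ℤ} (hq : 2 ≤ q)
    (hA : ∀ i, d i = 1 → ∀ a b, d a - d b ≠ q → A i a b = 0)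
    (H : ∀ i k j, d i = 1 → d k = 1 → d j = -1 → CocycleRel c A B i k j)
    {o : κ} (ho : d o = -1) {i : κ} (hi : d i = 1) (a b : κ) : A i a b = 0 := by
  have hdc : d c = 0 := (hc c).2 rfl
  have ne1 : ∀ i, d i = 1 → i ≠ c := fun i hi h => by rw [h] at hi; omega
  have ne2 : ∀ i, d i = -1 → i ≠ c := fun i hi h => by rw [h] at hi; omega
  by_cases h : d a - d b = q
  · have ha : d a = 1 := by have := hd a; have := hd b; omega
    have hb : d b = -1 := by have := hd a; have := hd b; omega
    have := H i a o hi ha ho o b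
    have hba : b ≠ a := fun h => by rw [h] at hb; omega
    have hbi : b ≠ i := fun h => by rw [h] at hb; omega
    simpa [hba, hbi, ne2 o ho] using this
  · exact hA i hi a b h

end SlGraded

namespace SlGraded

open LieAlgebra.SpecialLinear

variable {κ : Type} [Fintype κ] [DecidableEq κ]

/-- The degree function takes the values `1`, `0`, `-1`, the value `0` exactly at `c`. -/
structure IsContact (d : κ → ℤ) (c : κ) : Prop where
  eq_zero_iff : ∀ a, d a = 0 ↔ a = c
  cases : ∀ a, d a = 1 ∨ d a = 0 ∨ d a = -1
  exists_pos : ∃ i, d i = 1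
  exists_neg : ∃ j, d j = -1

namespace IsContact

variable {d : κ → ℤ} {c : κ} (h : IsContact d c)
include h

omit [Fintype κ] [DecidableEq κ] in
theorem center : d c = 0 := (h.eq_zero_iff c).2 rfl

omit [Fintype κ] [DecidableEq κ] in
theorem ne_of_pos {i : κ} (hi : d i = 1) : i ≠ c := fun e => by
  have := h.center
  rw [e] at hi
  omega

omit [Fintype κ] [DecidableEq κ] in
theorem ne_of_neg {j : κ} (hj : d j = -1) : j ≠ c := fun e => by
  have := h.center
  rw [e] at hj
  omega

omit [Fintype κ] [DecidableEq κ] in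
theorem neg : IsContact (fun a => -d a) c where
  eq_zero_iff a := by rw [neg_eq_zero]; exact h.eq_zero_iff a
  cases a := by have := h.cases a; omega
  exists_pos := by obtain ⟨j, hj⟩ := h.exists_neg; exact ⟨j, by omega⟩
  exists_neg := by obtain ⟨j, hj⟩ := h.exists_pos; exact ⟨j, by omega⟩

theorem cocycleRel {A B : κ → sl κ ℂ} {i k j : κ} (hi : d i = 1) (hk : d k = 1) (hj : d j = -1)
    (H : ⁅A i, ⁅(elem c k : sl κ ℂ), elem j c⁆⁆ +
      ⁅elem c i, ⁅A k, elem j c⁆ + ⁅elem c k, B j⁆⁆ = 0) :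
    CocycleRel c (fun i => (A i).1) (fun j => (B j).1) i k j := by
  have hjk : j ≠ k := fun e => by rw [e] at hj; omega
  intro a b
  have e : ⁅(elem c k : sl κ ℂ), elem j c⁆ = -elem j k := by
    rw [← lie_elem_elem (h.ne_of_neg hj) (h.ne_of_pos hk).symm hjk, lie_skew]
  rw [e, lie_neg] at H
  have := congrArg (fun X : sl κ ℂ => X.1 a b) H
  simp only [add_entry, neg_entry, zero_entry, lie_elem_entry _ hjk,
    lie_elem_entry _ (h.ne_of_neg hj), elem_lie_entry _ (h.ne_of_pos hi).symm,
    elem_lie_entry _ (h.ne_of_pos hk).symm, if_true] at this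
  simp only [add_sub_assoc] at this ⊢
  exact this

theorem cocycleRel_transpose {A B : κ → sl κ ℂ} {i j l : κ} (hi : d i = 1) (hj : d j = -1)
    (hl : d l = -1)
    (H : ⁅B j, ⁅(elem l c : sl κ ℂ), elem c i⁆⁆ +
      ⁅elem j c, ⁅B l, elem c i⁆ + ⁅elem l c, A i⁆⁆ = 0) :
    CocycleRel c (fun j => (B j).1.transpose) (fun i => (A i).1.transpose) j l i := by
  have hli : l ≠ i := fun e => by rw [e] at hl; omega
  intro a b
  rw [lie_elem_elem (h.ne_of_neg hl) (h.ne_of_pos hi).symm hli] at H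
  have := congrArg (fun X : sl κ ℂ => X.1 b a) H
  simp only [add_entry, zero_entry, lie_elem_entry _ hli,
    lie_elem_entry _ (h.ne_of_pos hi).symm, elem_lie_entry _ (h.ne_of_neg hj),
    elem_lie_entry _ (h.ne_of_neg hl), if_true] at this
  simp only [Matrix.transpose_apply]
  have e1 : (c = l) = False := eq_false (h.ne_of_neg hl).symm
  have e2 : (j = c) = False := eq_false (h.ne_of_neg hj)
  have e3 : (j = i) = False := eq_false fun e => by rw [e] at hj; omega
  simp only [e1, e2, e3, if_false] at this ⊢
  refine Eq.trans ?_ this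
  split_ifs <;> ring

theorem exists_of_entries {p : ℤ} {A B : κ → sl κ ℂ} (F : κ → κ → ℂ)
    (hF : ∀ a b, d a - d b ≠ p → F a b = 0)
    (hA : ∀ i, d i = 1 → ∀ a b,
      (A i).1 a b = (if b = i then F a c else 0) - (if a = c then F i b else 0))
    (hB : ∀ j, d j = -1 → ∀ a b,
      (B j).1 a b = (if b = c then F a j else 0) - (if a = j then F c b else 0)) :
    ∃ H ∈ grade d p, (∀ i, d i = 1 → ⁅H, elem c i⁆ = A i) ∧
      ∀ j, d j = -1 → ⁅H, elem j c⁆ = B j := by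
  set s : ℂ := (∑ a, F a a) / Fintype.card κ with hs
  have hN : (Fintype.card κ : ℂ) ≠ 0 := by
    have : Nonempty κ := ⟨c⟩
    exact_mod_cast Fintype.card_ne_zero
  let H : sl κ ℂ := ⟨Matrix.of fun a b => F a b - if a = b then s else 0, by
    change ∑ a, (F a a - if a = a then s else 0) = 0
    simp [hs, mul_div_cancel₀ _ hN]⟩
  have hH : ∀ a b, H.1 a b = F a b - if a = b then s else 0 := fun a b => rfl
  refine ⟨H, fun a b hab => ?_, fun i hi => ext_entry fun a b => ?_,
    fun j hj => ext_entry fun a b => ?_⟩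
  · rw [hH, hF a b hab]
    by_cases e : a = b
    · have hp : p ≠ 0 := fun h0 => hab (by rw [e, h0]; ring)
      have : s = 0 := by
        rw [hs, Finset.sum_eq_zero fun a _ => hF a a (by simpa using hp.symm), zero_div]
      simp [this]
    · simp [e]
  · rw [lie_elem_entry _ (h.ne_of_pos hi).symm, hA i hi, hH, hH]
    grind
  · rw [lie_elem_entry _ (h.ne_of_neg hj), hB j hj, hH, hH]
    grind

theorem exists_inner_zero {A B : κ → sl κ ℂ} (hA : ∀ i, d i = 1 → A i ∈ grade d (-1))
    (hB : ∀ j, d j = -1 → B j ∈ grade d (-1))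
    (hA' : ∀ i, d i = 1 → ∀ a b, a ≠ c → (A i).1 a b = 0)
    (hB' : ∀ j, d j = -1 → ∀ a b, b ≠ c → (B j).1 a b = 0) :
    ∃ H ∈ grade d 0, (∀ i, d i = 1 → ⁅H, elem c i⁆ = A i) ∧
      ∀ j, d j = -1 → ⁅H, elem j c⁆ = B j := by
  have hc := h.center
  refine h.exists_of_entries (fun a b => if d a = 1 ∧ d b = 1 then -(A a).1 c b else
    if d a = -1 ∧ d b = -1 then (B b).1 a c else 0) ?_ ?_ ?_
  · intro a b hab
    rw [if_neg (by omega), if_neg (by omega)]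
  · intro i hi a b
    have h1 := hA' i hi a b
    have h2 := hA i hi a b
    simp only [hi, hc]
    by_cases ha : a = c
    · subst ha
      by_cases hb : d b = 1
      · simp [hb]
      · rw [h2 (by omega)]; simp [hb]
    · rw [h1 ha]; simp [ha]
  · intro j hj a b
    have h1 := hB' j hj a b
    have h2 := hB j hj a b
    simp only [hj, hc]
    by_cases hb : b = c
    · subst hb
      by_cases ha : d a = -1
      · simp [ha]
      · rw [h2 (by omega)]; simp [ha]
    · rw [h1 hb]; simp [hb]

variable {A B : κ → sl κ ℂ}

theorem exists_inner_one
    (hA : ∀ i, d i = 1 → A i ∈ grade d 0) (hB : ∀ j, d j = -1 → B j ∈ grade d 0)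
    (C1 : ∀ i k j, d i = 1 → d k = 1 → d j = -1 →
      CocycleRel c (fun i => (A i).1) (fun j => (B j).1) i k j)
    (C2 : ∀ j l i, d i = 1 → d j = -1 → d l = -1 →
      CocycleRel c (fun j => (B j).1.transpose) (fun i => (A i).1.transpose) j l i) :
    ∃ H ∈ grade d 1, (∀ i, d i = 1 → ⁅H, elem c i⁆ = A i) ∧
      ∀ j, d j = -1 → ⁅H, elem j c⁆ = B j := by
  have hc := h.center
  obtain ⟨o, ho⟩ := h.exists_neg
  obtain ⟨o', ho'⟩ := h.exists_pos
  have eA := fun i hi => cocycle_degree_zero h.eq_zero_iff h.cases (fun i hi => hA i hi)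
    (fun i _ => sum_diag (A i)) C1 ho (i := i) hi
  have eB := fun j (hj : d j = -1) => cocycle_degree_zero (d := fun a => -d a) h.neg.eq_zero_iff
    h.neg.cases
    (A := fun j => (B j).1.transpose) (B := fun i => (A i).1.transpose)
    (fun i hi a b hab => hB i (by omega) b a (by omega))
    (fun i _ => sum_diag (B i))
    (fun i k j hi hk hj => C2 i k j (by omega) (by omega) (by omega)) (o := o') (by omega)
    (i := j) (by omega)
  simp only [Matrix.transpose_apply] at eB
  refine h.exists_of_entries (fun a b => if b = c ∧ d a = 1 then -(A a).1 c c else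
    if a = c ∧ d b = -1 then (B b).1 c c else 0) ?_ ?_ ?_
  · intro a b hab
    rw [if_neg, if_neg]
    · rintro ⟨rfl, h2⟩; omega
    · rintro ⟨rfl, h2⟩; omega
  · intro i hi a b
    have hic := h.ne_of_pos hi
    rw [eA i hi a b]
    simp only [hi]
    grind
  · intro j hj a b
    have hjc := h.ne_of_neg hj
    rw [eB j hj b a]
    simp only [hj]
    grind

theorem exists_inner_two
    (hA : ∀ i, d i = 1 → A i ∈ grade d 1) (hB : ∀ j, d j = -1 → B j ∈ grade d 1)
    (C1 : ∀ i k j, d i = 1 → d k = 1 → d j = -1 →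
      CocycleRel c (fun i => (A i).1) (fun j => (B j).1) i k j)
    (C2 : ∀ j l i, d i = 1 → d j = -1 → d l = -1 →
      CocycleRel c (fun j => (B j).1.transpose) (fun i => (A i).1.transpose) j l i) :
    ∃ H ∈ grade d 2, (∀ i, d i = 1 → ⁅H, elem c i⁆ = A i) ∧
      ∀ j, d j = -1 → ⁅H, elem j c⁆ = B j := by
  have hc := h.center
  obtain ⟨o, ho⟩ := h.exists_neg
  obtain ⟨o', ho'⟩ := h.exists_pos
  have eA := fun i hi => cocycle_degree_one h.eq_zero_iff h.cases (fun i hi => hA i hi)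
    C1 ho (i := i) hi
  have eB := fun j (hj : d j = -1) => cocycle_degree_one (d := fun a => -d a) h.neg.eq_zero_iff
    h.neg.cases
    (A := fun j => (B j).1.transpose) (B := fun i => (A i).1.transpose)
    (fun i hi a b hab => hB i (by omega) b a (by omega))
    (fun i k j hi hk hj => C2 i k j (by omega) (by omega) (by omega)) (o := o') (by omega)
    (i := j) (by omega)
  simp only [Matrix.transpose_apply] at eB
  refine h.exists_of_entries
    (fun a b => if d a = 1 ∧ d b = -1 then -(A a).1 c b else 0) ?_ ?_ ?_
  · intro a b hab
    rw [if_neg (by omega)]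
  · intro i hi a b
    have h1 := (eA i hi).1 a b
    simp only [hi, hc]
    by_cases ha : a = c
    · subst ha
      by_cases hb : d b = -1
      · simp [hb]
      · rw [h1 (by simp [hb])]; simp [hb]
    · rw [h1 (by simp [ha])]; simp [ha]
  · intro j hj a b
    have h1 := (eB j hj).1 b a
    simp only [hj, hc]
    by_cases hb : b = c
    · subst hb
      by_cases ha : d a = 1
      · have := (eA a ha).2 j hj
        simp [ha, this]
      · rw [h1 (by simp; omega)]; simp [ha]
    · rw [h1 (by simp [hb])]; simp [hb]

theorem exists_inner_ge_three {q : ℤ} (hq : 2 ≤ q)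
    (hA : ∀ i, d i = 1 → A i ∈ grade d q) (hB : ∀ j, d j = -1 → B j ∈ grade d q)
    (C1 : ∀ i k j, d i = 1 → d k = 1 → d j = -1 →
      CocycleRel c (fun i => (A i).1) (fun j => (B j).1) i k j)
    (C2 : ∀ j l i, d i = 1 → d j = -1 → d l = -1 →
      CocycleRel c (fun j => (B j).1.transpose) (fun i => (A i).1.transpose) j l i) :
    ∃ H ∈ grade d (q + 1), (∀ i, d i = 1 → ⁅H, elem c i⁆ = A i) ∧
      ∀ j, d j = -1 → ⁅H, elem j c⁆ = B j := by
  obtain ⟨o, ho⟩ := h.exists_neg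
  obtain ⟨o', ho'⟩ := h.exists_pos
  refine ⟨0, zero_mem _, fun i hi => ext_entry fun a b => ?_, fun j hj => ext_entry fun a b => ?_⟩
  · rw [zero_lie]
    exact (cocycle_degree_two h.eq_zero_iff h.cases hq (fun i hi => hA i hi) C1 ho hi a b).symm
  · rw [zero_lie]
    exact (cocycle_degree_two (d := fun a => -d a) h.neg.eq_zero_iff h.neg.cases hq
      (A := fun j => (B j).1.transpose) (B := fun i => (A i).1.transpose)
      (fun i hi a b hab => hB i (by omega) b a (by omega))
      (fun i k j hi hk hj => C2 i k j (by omega) (by omega) (by omega)) (o := o') (by omega)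
      (i := j) (by omega) b a).symm

/-- Every compatible system of values on the degree `-1` part is an inner derivation. -/
theorem exists_inner {p : ℤ} (hp : 1 ≤ p)
    (hA : ∀ i, d i = 1 → A i ∈ grade d (p - 1)) (hB : ∀ j, d j = -1 → B j ∈ grade d (p - 1))
    (C1 : ∀ i k j, d i = 1 → d k = 1 → d j = -1 →
      ⁅A i, ⁅(elem c k : sl κ ℂ), elem j c⁆⁆ +
        ⁅elem c i, ⁅A k, elem j c⁆ + ⁅elem c k, B j⁆⁆ = 0)
    (C2 : ∀ j l i, d i = 1 → d j = -1 → d l = -1 →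
      ⁅B j, ⁅(elem l c : sl κ ℂ), elem c i⁆⁆ +
        ⁅elem j c, ⁅B l, elem c i⁆ + ⁅elem l c, A i⁆⁆ = 0) :
    ∃ H ∈ grade d p, (∀ i, d i = 1 → ⁅H, elem c i⁆ = A i) ∧
      ∀ j, d j = -1 → ⁅H, elem j c⁆ = B j := by
  have D1 := fun i k j hi hk hj => h.cocycleRel hi hk hj (C1 i k j hi hk hj)
  have D2 := fun j l i hi hj hl => h.cocycleRel_transpose hi hj hl (C2 j l i hi hj hl)
  obtain rfl | rfl | hp : p = 1 ∨ p = 2 ∨ 3 ≤ p := by omega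
  · exact h.exists_inner_one hA hB D1 D2
  · exact h.exists_inner_two hA hB D1 D2
  · have := h.exists_inner_ge_three (by omega) hA hB D1 D2
    rwa [sub_add_cancel] at this

/-- A matrix commuting with the degree `-1` part is zero in nonnegative degree. -/
theorem eq_zero_of_lie {p : ℤ} (hp : 0 ≤ p) {X : sl κ ℂ} (hX : X ∈ grade d p)
    (h1 : ∀ i, d i = 1 → ⁅X, elem c i⁆ = 0) (h2 : ∀ j, d j = -1 → ⁅X, elem j c⁆ = 0) : X = 0 := by
  have hc := h.center
  have e1 : ∀ i, d i = 1 → ∀ a b,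
      (if b = i then X.1 a c else 0) - (if a = c then X.1 i b else 0) = 0 := fun i hi a b => by
    rw [← lie_elem_entry _ (h.ne_of_pos hi).symm, h1 i hi, zero_entry]
  have e2 : ∀ j, d j = -1 → ∀ a b,
      (if b = c then X.1 a j else 0) - (if a = j then X.1 c b else 0) = 0 := fun j hj a b => by
    rw [← lie_elem_entry _ (h.ne_of_neg hj), h2 j hj, zero_entry]
  obtain ⟨o, ho⟩ := h.exists_neg
  obtain ⟨o', ho'⟩ := h.exists_pos
  have key : ∀ a b, X.1 a b = if a = b then X.1 c c else 0 := by
    intro a b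
    rcases h.cases a with ha | ha | ha
    · have hac := h.ne_of_pos ha
      have := e1 a ha c b
      by_cases hab : a = b
      · simp [hab] at this ⊢
        linear_combination -this
      · simpa [hab, Ne.symm hab] using this
    · have hac := (h.eq_zero_iff a).1 ha
      subst hac
      by_cases hab : a = b
      · subst hab; simp
      · rw [if_neg hab]
        have := e2 o ho o b
        have hoa := h.ne_of_neg ho
        simpa [hab, Ne.symm hab] using this
    · have hac := h.ne_of_neg ha
      rcases h.cases b with hb | hb | hb
      · rw [hX a b (by omega)]
        rw [if_neg (fun e => by rw [e] at ha; omega)]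
      · have hbc := (h.eq_zero_iff b).1 hb
        subst hbc
        have := e1 o' ho' a o'
        simpa [hac] using this
      · have := e2 b hb a c
        by_cases hab : a = b
        · simp [hab] at this ⊢
          linear_combination this
        · simpa [hab] using this
  have hcc : X.1 c c = 0 := by
    have := sum_diag X
    rw [Finset.sum_congr rfl fun a _ => key a a] at this
    simp only [if_true, Finset.sum_const, Finset.card_univ, nsmul_eq_mul] at this
    have hN : (Fintype.card κ : ℂ) ≠ 0 := by
      have : Nonempty κ := ⟨c⟩
      exact_mod_cast Fintype.card_ne_zero
    exact (mul_eq_zero.1 this).resolve_left hN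
  exact ext_entry fun a b => by rw [key, hcc]; simp

theorem gla_transitive [Nonempty κ] : (gla d).Transitive := by
  intro p hp X hX hcomm
  have hc := h.center
  refine h.eq_zero_of_lie hp hX (fun i hi => hcomm (-1) (by omega) _ ?_)
    (fun j hj => hcomm (-1) (by omega) _ ?_)
  · have := elem_mem (d := d) c i
    rwa [hc, hi] at this
  · have := elem_mem (d := d) j c
    rwa [hc, hj] at this

end IsContact

end SlGraded

section Generation

variable {L : Type} [LieRing L] [LieAlgebra ℂ L] {M : GLA L} {e f : Submodule ℂ L}

theorem IsPPFGLA.neg_two_le (h : IsPPFGLA M e f) {S : Submodule ℂ L}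
    (hS : ∀ x ∈ e, ∀ y ∈ f, ⁅x, y⁆ ∈ S) : M.g (-2) ≤ S := by
  have : M.g (-2) = M.g (-1 - 1) := by norm_num
  rw [this, h.fgla.generated (-1) (by norm_num), Submodule.span_le]
  rintro z ⟨u, hu, w, hw, rfl⟩
  rw [← h.sup_eq] at hu hw
  obtain ⟨x, hx, y, hy, rfl⟩ := Submodule.mem_sup.1 hu
  obtain ⟨x', hx', y', hy', rfl⟩ := Submodule.mem_sup.1 hw
  rw [add_lie, lie_add, lie_add, h.lie_ee x hx x' hx', h.lie_ff y hy y' hy', zero_add, add_zero,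
    ← lie_skew y x']
  exact S.add_mem (hS x hx y' hy') (S.neg_mem (hS x' hx' y hy))

theorem IsPPFGLA.eq_top (h : IsPPFGLA M e f) (hk : M.IsOfKind 2) {S : Submodule ℂ L}
    (he : e ≤ S) (hf : f ≤ S) (hS : ∀ x ∈ e, ∀ y ∈ f, ⁅x, y⁆ ∈ S) : S = ⊤ := by
  rw [eq_top_iff, ← M.internal.submodule_iSup_eq_top]
  refine iSup_le fun p => ?_
  obtain hp | rfl | rfl | hp : p < -2 ∨ p = -2 ∨ p = -1 ∨ 0 ≤ p := by omega
  · rw [hk.2 p (by exact_mod_cast hp)]; exact bot_le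
  · exact h.neg_two_le hS
  · rw [← h.sup_eq]; exact sup_le he hf
  · rw [h.fgla.nonneg p hp]; exact bot_le

theorem GLA.IsOfKind.lie_lie_eq_zero (hk : M.IsOfKind 2) {x y z : L}
    (hx : x ∈ M.g (-1)) (hy : y ∈ M.g (-1)) (hz : z ∈ M.g (-1)) : ⁅x, ⁅y, z⁆⁆ = 0 := by
  have := M.bracket_mem _ _ x hx _ (M.bracket_mem _ _ y hy z hz)
  rw [hk.2 _ (by norm_num)] at this
  exact (Submodule.mem_bot ℂ).1 this

theorem IsPPFGLA.exists_dual_family {ι : Type} [Fintype ι] [DecidableEq ι] (h : IsPPFGLA M e f)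
    (b : Module.Basis ι ℂ e) :
    ∃ ξ : ι → Module.Dual ℂ L, (∀ i, ∀ y ∈ f, ξ i y = 0) ∧
      ∀ i k, ξ i (b k) = if k = i then 1 else 0 := by
  obtain ⟨g, hg⟩ := (f.mkQ ∘ₗ e.subtype).exists_leftInverse_of_injective <| by
    rw [LinearMap.ker_eq_bot']
    intro z hz
    have hzf : (z : L) ∈ f := (Submodule.Quotient.mk_eq_zero f).1 hz
    have hz0 : (z : L) ∈ e ⊓ f := ⟨z.2, hzf⟩
    rw [h.inf_eq, Submodule.mem_bot] at hz0
    exact Subtype.ext hz0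
  refine ⟨fun i => b.coord i ∘ₗ g ∘ₗ f.mkQ, fun i y hy => ?_, fun i k => ?_⟩
  · have : f.mkQ y = 0 := (Submodule.Quotient.mk_eq_zero f).2 hy
    simp only [LinearMap.comp_apply, this, map_zero]
  · have : g (f.mkQ (b k)) = b k := LinearMap.congr_fun hg (b k)
    rw [LinearMap.comp_apply, LinearMap.comp_apply, this, Module.Basis.coord_apply,
      Module.Basis.repr_self, Finsupp.single_apply]

end Generation

namespace SlGraded

open LieAlgebra.SpecialLinear

variable {κ : Type} [Fintype κ] [DecidableEq κ]
variable {L : Type} [LieRing L] [LieAlgebra ℂ L]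

/-- Dual systems of vectors and functionals on a pseudo-product FGLA of the second kind. -/
structure Frame (e f : Submodule ℂ L) (d : κ → ℤ) where
  x : κ → L
  y : κ → L
  α : κ → Module.Dual ℂ L
  β : κ → Module.Dual ℂ L
  γ : κ → κ → Module.Dual ℂ L
  x_mem : ∀ i, x i ∈ e
  y_mem : ∀ j, y j ∈ f
  x_eq_zero : ∀ i, d i ≠ 1 → x i = 0
  y_eq_zero : ∀ j, d j ≠ -1 → y j = 0
  le_span_x : e ≤ Submodule.span ℂ (Set.range x)
  le_span_y : f ≤ Submodule.span ℂ (Set.range y)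
  α_x : ∀ i k, d i = 1 → d k = 1 → α i (x k) = if i = k then 1 else 0
  α_y : ∀ i k, d i = 1 → α i (y k) = 0
  α_lie : ∀ i (z w : L), d i = 1 → α i ⁅z, w⁆ = 0
  β_y : ∀ j k, d j = -1 → d k = -1 → β j (y k) = if j = k then 1 else 0
  β_x : ∀ j k, d j = -1 → β j (x k) = 0
  β_lie : ∀ j (z w : L), d j = -1 → β j ⁅z, w⁆ = 0
  γ_x : ∀ i j k, d i = 1 → d j = -1 → γ i j (x k) = 0
  γ_y : ∀ i j k, d i = 1 → d j = -1 → γ i j (y k) = 0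
  γ_lie : ∀ i j (z w : L), d i = 1 → d j = -1 → γ i j ⁅z, w⁆ = α i z * β j w - α i w * β j z

theorem exists_frame {M : GLA L} {e f : Submodule ℂ L} {m n : ℕ} {d : κ → ℤ} {c : κ}
    (hd : IsContact d c) (h : IsFreePPFGLA M e f m n 2)
    (hm : Fintype.card {i // d i = 1} = m) (hn : Fintype.card {j // d j = -1} = n) :
    Nonempty (Frame e f d) := by
  have hpp := h.1
  obtain ⟨i₀, hi₀⟩ := hd.exists_pos
  obtain ⟨j₀, hj₀⟩ := hd.exists_neg
  have : FiniteDimensional ℂ L := hpp.fgla.fd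
  let b : Module.Basis {i // d i = 1} ℂ e :=
    (Module.finBasisOfFinrankEq ℂ e h.2.2.1).reindex (Fintype.equivFinOfCardEq hm).symm
  let b' : Module.Basis {j // d j = -1} ℂ f :=
    (Module.finBasisOfFinrankEq ℂ f h.2.2.2.1).reindex (Fintype.equivFinOfCardEq hn).symm
  obtain ⟨ξ, hξ, hξb⟩ := hpp.exists_dual_family b
  obtain ⟨η, hη, hηb⟩ := hpp.symm.exists_dual_family b'
  have H := fun (i : {i // d i = 1}) (j : {j // d j = -1}) =>
    h.exists_hom_filiform (by norm_num) (ξ i) (η j) (hξ i) (hη j) (b i).2 (b' j).2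
      (by simp [hξb]) (by simp [hηb])
  choose Φ hΦe hΦf using H
  let fstL : Filiform 2 →ₗ[ℂ] ℂ := ⟨⟨fun z => z.1, fun _ _ => rfl⟩, fun _ _ => rfl⟩
  let sndL : Fin 2 → Filiform 2 →ₗ[ℂ] ℂ :=
    fun k => ⟨⟨fun z => z.2 k, fun _ _ => rfl⟩, fun _ _ => rfl⟩
  have hfst : ∀ i j z, (Φ i j z).1 = (Φ i ⟨j₀, hj₀⟩ z).1 := by
    intro i j
    have : LinearMap.eqLocus (fstL ∘ₗ (Φ i j).toLinearMap)
        (fstL ∘ₗ (Φ i ⟨j₀, hj₀⟩).toLinearMap) = ⊤ := by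
      refine hpp.eq_top h.2.1 (fun z hz => ?_) (fun z hz => ?_) fun u hu v hv => ?_
      · change (Φ i j z).1 = (Φ i ⟨j₀, hj₀⟩ z).1
        rw [hΦe i j z hz, hΦe i _ z hz]
      · change (Φ i j z).1 = (Φ i ⟨j₀, hj₀⟩ z).1
        rw [hΦf i j z hz, hΦf i _ z hz]
        simp
      · change (Φ i j _).1 = (Φ i ⟨j₀, hj₀⟩ _).1
        rw [LieHom.map_lie, LieHom.map_lie, Filiform.lie_fst, Filiform.lie_fst]
    exact fun z => LinearMap.mem_eqLocus.1 (this.ge (Submodule.mem_top (x := z)))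
  have hsnd0 : ∀ i j (z w : L), (Φ i j ⁅z, w⁆).2 0 = 0 := by
    intro i j z w
    rw [LieHom.map_lie, Filiform.lie_snd]
    simp [Filiform.shift]
  have hsnd : ∀ i j z, (Φ i j z).2 0 = (Φ ⟨i₀, hi₀⟩ j z).2 0 := by
    intro i j
    have : LinearMap.eqLocus (sndL 0 ∘ₗ (Φ i j).toLinearMap)
        (sndL 0 ∘ₗ (Φ ⟨i₀, hi₀⟩ j).toLinearMap) = ⊤ := by
      refine hpp.eq_top h.2.1 (fun z hz => ?_) (fun z hz => ?_) fun u hu v hv => ?_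
      · change (Φ i j z).2 0 = (Φ ⟨i₀, hi₀⟩ j z).2 0
        rw [hΦe i j z hz, hΦe _ j z hz]
        simp
      · change (Φ i j z).2 0 = (Φ ⟨i₀, hi₀⟩ j z).2 0
        rw [hΦf i j z hz, hΦf _ j z hz]
      · change (Φ i j _).2 0 = (Φ ⟨i₀, hi₀⟩ j _).2 0
        rw [hsnd0, hsnd0]
    exact fun z => LinearMap.mem_eqLocus.1 (this.ge (Submodule.mem_top (x := z)))
  have hsnd1 : ∀ i j (z w : L), (Φ i j ⁅z, w⁆).2 1 =
      (Φ i j z).1 * (Φ i j w).2 0 - (Φ i j w).1 * (Φ i j z).2 0 := by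
    intro i j z w
    rw [LieHom.map_lie, Filiform.lie_snd]
    simp [Filiform.shift]
  let x : κ → L := fun i => if hi : d i = 1 then b ⟨i, hi⟩ else 0
  let y : κ → L := fun j => if hj : d j = -1 then b' ⟨j, hj⟩ else 0
  have x_mem : ∀ i, x i ∈ e := fun i => by
    by_cases hi : d i = 1
    · simp only [x, dif_pos hi]; exact (b _).2
    · simp only [x, dif_neg hi]; exact e.zero_mem
  have y_mem : ∀ i, y i ∈ f := fun i => by
    by_cases hi : d i = -1
    · simp only [y, dif_pos hi]; exact (b' _).2
    · simp only [y, dif_neg hi]; exact f.zero_mem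
  exact ⟨{
    x := x
    y := y
    α := fun i => if hi : d i = 1 then fstL ∘ₗ (Φ ⟨i, hi⟩ ⟨j₀, hj₀⟩).toLinearMap else 0
    β := fun j => if hj : d j = -1 then sndL 0 ∘ₗ (Φ ⟨i₀, hi₀⟩ ⟨j, hj⟩).toLinearMap else 0
    γ := fun i j => if hij : d i = 1 ∧ d j = -1 then
      sndL 1 ∘ₗ (Φ ⟨i, hij.1⟩ ⟨j, hij.2⟩).toLinearMap else 0
    x_mem := x_mem
    y_mem := y_mem
    x_eq_zero := fun i hi => dif_neg hi
    y_eq_zero := fun i hi => dif_neg hi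
    le_span_x := by
      intro z hz
      have : z = ∑ i, b.repr ⟨z, hz⟩ i • (b i : L) := by
        have := congrArg Subtype.val (b.sum_repr ⟨z, hz⟩).symm
        rwa [AddSubmonoidClass.coe_finsetSum] at this
      rw [this]
      refine sum_mem fun i _ => Submodule.smul_mem _ _ (Submodule.subset_span ⟨i, ?_⟩)
      simp only [x, dif_pos i.2]
    le_span_y := by
      intro z hz
      have : z = ∑ i, b'.repr ⟨z, hz⟩ i • (b' i : L) := by
        have := congrArg Subtype.val (b'.sum_repr ⟨z, hz⟩).symm
        rwa [AddSubmonoidClass.coe_finsetSum] at this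
      rw [this]
      refine sum_mem fun i _ => Submodule.smul_mem _ _ (Submodule.subset_span ⟨i, ?_⟩)
      simp only [y, dif_pos i.2]
    α_x := fun i k hi hk => by
      rw [dif_pos hi]
      change (Φ _ _ (x k)).1 = _
      rw [hΦe _ _ _ (x_mem k)]
      by_cases hik : i = k
      · subst hik; simp [x, hk, hξb]
      · simp [x, hk, hξb, hik, Ne.symm hik]
    α_y := fun i k hi => by
      rw [dif_pos hi]
      change (Φ _ _ (y k)).1 = _
      rw [hΦf _ _ _ (y_mem k)]
      simp
    α_lie := fun i z w hi => by
      rw [dif_pos hi]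
      change (Φ _ _ ⁅z, w⁆).1 = _
      rw [LieHom.map_lie, Filiform.lie_fst]
    β_y := fun i k hi hk => by
      rw [dif_pos hi]
      change (Φ _ _ (y k)).2 0 = _
      rw [hΦf _ _ _ (y_mem k)]
      by_cases hik : i = k
      · subst hik; simp [y, hk, hηb]
      · simp [y, hk, hηb, hik, Ne.symm hik]
    β_x := fun i k hi => by
      rw [dif_pos hi]
      change (Φ _ _ (x k)).2 0 = _
      rw [hΦe _ _ _ (x_mem k)]
      simp
    β_lie := fun i z w hi => by
      rw [dif_pos hi]
      exact hsnd0 _ _ z w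
    γ_x := fun i j k hi hj => by
      rw [dif_pos ⟨hi, hj⟩]
      change (Φ _ _ (x k)).2 1 = _
      rw [hΦe _ _ _ (x_mem k)]
      simp
    γ_y := fun i j k hi hj => by
      rw [dif_pos ⟨hi, hj⟩]
      change (Φ _ _ (y k)).2 1 = _
      rw [hΦf _ _ _ (y_mem k)]
      simp
    γ_lie := fun i j z w hi hj => by
      rw [dif_pos ⟨hi, hj⟩, dif_pos hi, dif_pos hj]
      change (Φ _ _ ⁅z, w⁆).2 1 = (Φ _ _ z).1 * (Φ _ _ w).2 0 - (Φ _ _ w).1 * (Φ _ _ z).2 0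
      rw [hsnd1, hfst _ _ z, hfst _ _ w, hsnd _ _ z, hsnd _ _ w] }⟩

end SlGraded

namespace SlGraded

open LieAlgebra.SpecialLinear

variable {κ : Type} [Fintype κ] [DecidableEq κ]
variable {L : Type} [LieRing L] [LieAlgebra ℂ L]

theorem sum_entry {τ : Type} (s : Finset τ) (g : τ → sl κ ℂ) (a b : κ) :
    (∑ k ∈ s, g k).1 a b = ∑ k ∈ s, (g k).1 a b := by
  rw [AddSubmonoidClass.coe_finsetSum, Matrix.sum_apply]

namespace Frame

variable {e f : Submodule ℂ L} {d : κ → ℤ} {c : κ} (F : Frame e f d) (hd : IsContact d c)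

/-- The matrix representing an element of the pseudo-product FGLA. -/
def toMatrix (c : κ) (z : L) : Matrix κ κ ℂ := Matrix.of fun a b =>
  if d b = 1 then (if a = c then F.α b z else if d a = -1 then -F.γ b a z else 0)
  else if b = c ∧ d a = -1 then F.β a z else 0

omit [Fintype κ] in
include hd in
theorem toMatrix_diag (z : L) (a : κ) : F.toMatrix c z a a = 0 := by
  have h1 := hd.center
  change (if d a = 1 then (if a = c then F.α a z else if d a = -1 then -F.γ a a z else 0)
    else if a = c ∧ d a = -1 then F.β a z else 0) = 0
  split_ifs with h2 h3 h4 h5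
  · rw [h3] at h2; omega
  · omega
  · rfl
  · rw [h5.1] at h5; omega
  · rfl

/-- The embedding into the special linear Lie algebra, as a linear map. -/
def toSlLinear : L →ₗ[ℂ] sl κ ℂ where
  toFun z := ⟨F.toMatrix c z, Finset.sum_eq_zero fun a _ => F.toMatrix_diag hd z a⟩
  map_add' z w := ext_entry fun a b => by
    change F.toMatrix c (z + w) a b = F.toMatrix c z a b + F.toMatrix c w a b
    simp only [toMatrix, Matrix.of_apply, map_add]
    split_ifs <;> ring
  map_smul' s z := ext_entry fun a b => by
    change F.toMatrix c (s • z) a b = s * F.toMatrix c z a b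
    simp only [toMatrix, Matrix.of_apply, map_smul, smul_eq_mul]
    split_ifs <;> ring

theorem toSlLinear_entry (z : L) (a b : κ) : (F.toSlLinear hd z).1 a b =
    if d b = 1 then (if a = c then F.α b z else if d a = -1 then -F.γ b a z else 0)
      else if b = c ∧ d a = -1 then F.β a z else 0 := rfl

theorem sum_toSlLinear_mul (z w : L) (a b : κ) :
    ∑ k, (F.toSlLinear hd z).1 a k * (F.toSlLinear hd w).1 k b =
      if d a = -1 ∧ d b = 1 then F.β a z * F.α b w else 0 := by
  have hc := hd.center
  rw [Finset.sum_eq_single c]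
  · simp only [toSlLinear_entry, hc]
    by_cases ha : d a = -1 <;> by_cases hb : d b = 1 <;> simp [ha, hb]
  · intro k _ hk
    simp only [toSlLinear_entry]
    by_cases h1 : d k = 1
    · simp [h1, hk]
    · simp [h1, hk]
  · simp

/-- The embedding into the special linear Lie algebra. -/
def toSl : L →ₗ⁅ℂ⁆ sl κ ℂ :=
  { F.toSlLinear hd with
    map_lie' := by
      intro z w
      refine ext_entry fun a b => ?_
      change (F.toSlLinear hd ⁅z, w⁆).1 a b = ⁅F.toSlLinear hd z, F.toSlLinear hd w⁆.1 a b
      rw [lie_entry, sum_toSlLinear_mul, sum_toSlLinear_mul, toSlLinear_entry]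
      by_cases hb : d b = 1
      · by_cases ha : d a = -1
        · have hac := hd.ne_of_neg ha
          simp only [ha, hb, hac, if_true, if_false, and_self, F.γ_lie b a z w hb ha]
          ring
        · simp [ha, hb, F.α_lie b z w hb]
      · by_cases ha : d a = -1
        · simp [ha, hb, F.β_lie a z w ha]
        · simp [ha, hb] }

theorem toSl_entry (z : L) (a b : κ) : (F.toSl hd z).1 a b =
    if d b = 1 then (if a = c then F.α b z else if d a = -1 then -F.γ b a z else 0)
      else if b = c ∧ d a = -1 then F.β a z else 0 := rfl

theorem toSl_x {i : κ} (hi : d i = 1) : F.toSl hd (F.x i) = elem c i := by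
  refine ext_entry fun a b => ?_
  rw [toSl_entry, elem_entry (hd.ne_of_pos hi).symm]
  by_cases hb : d b = 1
  · have h1 := F.α_x b i hb hi
    by_cases ha : d a = -1
    · have hac := hd.ne_of_neg ha
      simp [hb, ha, hac, F.γ_x b a i hb ha]
    · by_cases hac : a = c <;> simp [hb, ha, hac, h1]
  · have hbi : b ≠ i := fun h => hb (h ▸ hi)
    by_cases ha : d a = -1
    · simp [hb, hbi, F.β_x a i ha]
    · simp [hb, ha, hbi]

theorem toSl_y {j : κ} (hj : d j = -1) : F.toSl hd (F.y j) = elem j c := by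
  have hc := hd.center
  refine ext_entry fun a b => ?_
  rw [toSl_entry, elem_entry (hd.ne_of_neg hj)]
  by_cases hb : d b = 1
  · have hbc := hd.ne_of_pos hb
    by_cases ha : d a = -1
    · have hac := hd.ne_of_neg ha
      simp [hb, ha, hac, hbc, F.γ_y b a j hb ha]
    · simp [hb, ha, hbc, F.α_y b j hb]
  · by_cases ha : d a = -1
    · simp only [hb, ha, F.β_y a j ha hj, if_false, and_true]
      grind
    · have haj : a ≠ j := fun h => ha (h ▸ hj)
      simp [hb, ha, haj]

/-- The linear retraction of the embedding. -/
def ofSl (c : κ) : sl κ ℂ →ₗ[ℂ] L where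
  toFun A := ∑ i, A.1 c i • F.x i + ∑ j, A.1 j c • F.y j
    - ∑ i, ∑ j, A.1 j i • ⁅F.x i, F.y j⁆
  map_add' A B := by
    simp only [add_entry, add_smul, Finset.sum_add_distrib]
    abel
  map_smul' s A := by
    simp only [smul_entry, mul_smul, ← Finset.smul_sum, RingHom.id_apply, smul_sub, smul_add]

theorem ofSl_apply (A : sl κ ℂ) : F.ofSl c A = ∑ i, A.1 c i • F.x i + ∑ j, A.1 j c • F.y j
    - ∑ i, ∑ j, A.1 j i • ⁅F.x i, F.y j⁆ := rfl

include hd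

theorem ofSl_elem_left {i : κ} (hi : d i = 1) : F.ofSl c (elem c i) = F.x i := by
  have hc := hd.center
  have hic := hd.ne_of_pos hi
  have hyc : F.y c = 0 := F.y_eq_zero c (by omega)
  rw [ofSl_apply]
  simp [elem_entry hic.symm, ite_and, hic.symm, hyc]

theorem ofSl_elem_right {j : κ} (hj : d j = -1) : F.ofSl c (elem j c) = F.y j := by
  have hc := hd.center
  have hjc := hd.ne_of_neg hj
  have hxc : F.x c = 0 := F.x_eq_zero c (by omega)
  rw [ofSl_apply]
  simp [elem_entry hjc, ite_and, hjc.symm, hxc]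

theorem ofSl_lie {i j : κ} (hi : d i = 1) (hj : d j = -1) :
    F.ofSl c ⁅(elem c i : sl κ ℂ), elem j c⁆ = ⁅F.x i, F.y j⁆ := by
  have hic := hd.ne_of_pos hi
  have hjc := hd.ne_of_neg hj
  have hji : j ≠ i := fun e => by rw [e] at hj; omega
  rw [← lie_skew, lie_elem_elem hjc hic.symm hji, map_neg, ofSl_apply]
  simp [elem_entry hji, ite_and, hjc.symm, hic.symm]

omit hd [Fintype κ] in
theorem eq_top {M : GLA L} (hpp : IsPPFGLA M e f) (hk : M.IsOfKind 2) {S : Submodule ℂ L}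
    (hx : ∀ i, d i = 1 → F.x i ∈ S) (hy : ∀ j, d j = -1 → F.y j ∈ S)
    (hxy : ∀ i j, d i = 1 → d j = -1 → ⁅F.x i, F.y j⁆ ∈ S) : S = ⊤ := by
  have hx' : ∀ i, F.x i ∈ S := fun i => by
    by_cases hi : d i = 1
    · exact hx i hi
    · rw [F.x_eq_zero i hi]; exact S.zero_mem
  have hy' : ∀ i, F.y i ∈ S := fun i => by
    by_cases hi : d i = -1
    · exact hy i hi
    · rw [F.y_eq_zero i hi]; exact S.zero_mem
  have hxy' : ∀ i j, ⁅F.x i, F.y j⁆ ∈ S := fun i j => by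
    by_cases hi : d i = 1
    · by_cases hj : d j = -1
      · exact hxy i j hi hj
      · rw [F.y_eq_zero j hj, lie_zero]; exact S.zero_mem
    · rw [F.x_eq_zero i hi, zero_lie]; exact S.zero_mem
  refine hpp.eq_top hk (F.le_span_x.trans (Submodule.span_le.2 ?_))
    (F.le_span_y.trans (Submodule.span_le.2 ?_)) fun u hu v hv => ?_
  · rintro _ ⟨i, rfl⟩; exact hx' i
  · rintro _ ⟨i, rfl⟩; exact hy' i
  · have h1 : ∀ i, ⁅F.x i, v⁆ ∈ S := fun i => by
      have : f ≤ S.comap (LieAlgebra.ad ℂ L (F.x i)) := by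
        refine F.le_span_y.trans (Submodule.span_le.2 ?_)
        rintro _ ⟨j, rfl⟩
        exact hxy' i j
      exact this hv
    have : e ≤ S.comap (LieAlgebra.ad ℂ L v) := by
      refine F.le_span_x.trans (Submodule.span_le.2 ?_)
      rintro _ ⟨i, rfl⟩
      change ⁅v, F.x i⁆ ∈ S
      rw [← lie_skew]
      exact S.neg_mem (h1 i)
    rw [← lie_skew]
    exact S.neg_mem (this hu)

theorem ofSl_toSl {M : GLA L} (hpp : IsPPFGLA M e f) (hk : M.IsOfKind 2) (z : L) :
    F.ofSl c (F.toSl hd z) = z := by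
  have : LinearMap.eqLocus (F.ofSl c ∘ₗ (F.toSl hd).toLinearMap) LinearMap.id = ⊤ := by
    refine F.eq_top hpp hk (fun i hi => ?_) (fun j hj => ?_) fun i j hi hj => ?_
    · change F.ofSl c (F.toSl hd (F.x i)) = F.x i
      rw [F.toSl_x hd hi, F.ofSl_elem_left hd hi]
    · change F.ofSl c (F.toSl hd (F.y j)) = F.y j
      rw [F.toSl_y hd hj, F.ofSl_elem_right hd hj]
    · change F.ofSl c (F.toSl hd ⁅F.x i, F.y j⁆) = ⁅F.x i, F.y j⁆
      rw [LieHom.map_lie, F.toSl_x hd hi, F.toSl_y hd hj, F.ofSl_lie hd hi hj]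
  exact LinearMap.mem_eqLocus.1 (this.ge (Submodule.mem_top (x := z)))

theorem toSl_injective {M : GLA L} (hpp : IsPPFGLA M e f) (hk : M.IsOfKind 2) :
    Function.Injective (F.toSl hd) :=
  Function.LeftInverse.injective (g := F.ofSl c) (F.ofSl_toSl hd hpp hk)

theorem toSl_ofSl {p : ℤ} (hp : p < 0) {A : sl κ ℂ} (hA : A ∈ grade d p) :
    F.toSl hd (F.ofSl c A) = A := by
  have hc := hd.center
  have h1 : ∀ i, A.1 c i • F.toSl hd (F.x i) = A.1 c i • elem c i := fun i => by
    by_cases hi : d i = 1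
    · rw [F.toSl_x hd hi]
    · rw [hA c i (by have := hd.cases i; omega), zero_smul, zero_smul]
  have h2 : ∀ j, A.1 j c • F.toSl hd (F.y j) = A.1 j c • elem j c := fun j => by
    by_cases hj : d j = -1
    · rw [F.toSl_y hd hj]
    · rw [hA j c (by have := hd.cases j; omega), zero_smul, zero_smul]
  have h3 : ∀ i j, A.1 j i • F.toSl hd ⁅F.x i, F.y j⁆ =
      if d i = 1 ∧ d j = -1 then -(A.1 j i • elem j i) else 0 := fun i j => by
    by_cases h : d i = 1 ∧ d j = -1
    · have hji : j ≠ i := fun e => by rw [e] at h; omega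
      rw [if_pos h, LieHom.map_lie, F.toSl_x hd h.1, F.toSl_y hd h.2, ← lie_skew,
        lie_elem_elem (hd.ne_of_neg h.2) (hd.ne_of_pos h.1).symm hji, smul_neg]
    · rw [if_neg h]
      by_cases hi : d i = 1
      · rw [F.y_eq_zero j (fun hj => h ⟨hi, hj⟩), lie_zero, map_zero, smul_zero]
      · rw [F.x_eq_zero i hi, zero_lie, map_zero, smul_zero]
  rw [ofSl_apply]
  simp only [map_add, map_sub, map_sum, map_smul, h1, h2, h3]
  refine ext_entry fun a b => ?_
  have h4 : ∀ i, (A.1 c i • (elem c i : sl κ ℂ)).1 a b = if b = i ∧ a = c then A.1 a b else 0 :=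
    fun i => by
      by_cases hi : c = i
      · rw [smul_entry, hA c i (by subst hi; omega)]
        split_ifs with h
        · rw [hA a b (by rw [h.1, h.2, ← hi]; omega), zero_mul]
        · rw [zero_mul]
      · rw [smul_entry, elem_entry hi]
        grind
  have h5 : ∀ j, (A.1 j c • (elem j c : sl κ ℂ)).1 a b = if a = j ∧ b = c then A.1 a b else 0 :=
    fun j => by
      by_cases hj : j = c
      · rw [smul_entry, hA j c (by subst hj; omega)]
        split_ifs with h
        · rw [hA a b (by rw [h.1, h.2, ← hj]; omega), zero_mul]
        · rw [zero_mul]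
      · rw [smul_entry, elem_entry hj]
        grind
  have h6 : ∀ i j, ((if d i = 1 ∧ d j = -1 then -(A.1 j i • elem j i) else 0 : sl κ ℂ)).1 a b =
      if a = j ∧ b = i then (if d b = 1 ∧ d a = -1 then -A.1 a b else 0) else 0 := fun i j => by
    by_cases h : d i = 1 ∧ d j = -1
    · have hji : j ≠ i := fun e => by rw [e] at h; omega
      rw [if_pos h, neg_entry, smul_entry, elem_entry hji]
      grind
    · rw [if_neg h, zero_entry]
      grind
  rw [sub_entry, add_entry, sum_entry, sum_entry, sum_entry]
  simp only [h4, h5, sum_entry, h6]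
  simp only [ite_and, Finset.sum_ite_eq, Finset.mem_univ, if_true]
  have h7 : d a - d b ≠ p → A.1 a b = 0 := hA a b
  have ha := hd.cases a
  have hb := hd.cases b
  have ha' := hd.eq_zero_iff a
  have hb' := hd.eq_zero_iff b
  by_cases hab : d a - d b = p
  · by_cases hac : a = c
    · have h8 : b ≠ c := fun h => by rw [hac, h] at hab; omega
      have h9 : d b = 1 := by rw [hac] at hab; omega
      simp [hac, h8, h9, hc]
    · by_cases hbc : b = c
      · simp [hac, hbc, hc]
      · have h10 := mt ha'.1 hac
        have h11 := mt hb'.1 hbc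
        have h8 : d b = 1 := by omega
        have h9 : d a = -1 := by omega
        simp [hac, hbc, h8, h9]
  · simp [h7 hab]

theorem ofSl_mem_left {A : sl κ ℂ} (hA : ∀ a b, a ≠ c → A.1 a b = 0) : F.ofSl c A ∈ e := by
  have hc := hd.center
  rw [ofSl_apply, Finset.sum_eq_zero (s := Finset.univ) (f := fun j => A.1 j c • F.y j),
    Finset.sum_eq_zero (s := Finset.univ) (f := fun i => ∑ j, A.1 j i • ⁅F.x i, F.y j⁆)]
  · rw [add_zero, sub_zero]
    exact sum_mem fun i _ => e.smul_mem _ (F.x_mem i)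
  · intro i _
    refine Finset.sum_eq_zero fun j _ => ?_
    by_cases hj : j = c
    · rw [hj, F.y_eq_zero c (by omega), lie_zero, smul_zero]
    · rw [hA j i hj, zero_smul]
  · intro j _
    by_cases hj : j = c
    · rw [hj, F.y_eq_zero c (by omega), smul_zero]
    · rw [hA j c hj, zero_smul]

theorem ofSl_mem_right {A : sl κ ℂ} (hA : ∀ a b, b ≠ c → A.1 a b = 0) : F.ofSl c A ∈ f := by
  have hc := hd.center
  rw [ofSl_apply, Finset.sum_eq_zero (s := Finset.univ) (f := fun i => A.1 c i • F.x i),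
    Finset.sum_eq_zero (s := Finset.univ) (f := fun i => ∑ j, A.1 j i • ⁅F.x i, F.y j⁆)]
  · rw [zero_add, sub_zero]
    exact sum_mem fun i _ => f.smul_mem _ (F.y_mem i)
  · intro i _
    refine Finset.sum_eq_zero fun j _ => ?_
    by_cases hi : i = c
    · rw [hi, F.x_eq_zero c (by omega), zero_lie, smul_zero]
    · rw [hA j i hi, zero_smul]
  · intro i _
    by_cases hi : i = c
    · rw [hi, F.x_eq_zero c (by omega), smul_zero]
    · rw [hA c i hi, zero_smul]

end Frame

end SlGraded

namespace SlGraded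

open LieAlgebra.SpecialLinear

variable {κ : Type} [Fintype κ] [DecidableEq κ]
variable {L : Type} [LieRing L] [LieAlgebra ℂ L]

/-- The matrices supported on the row `c`. -/
def row (c : κ) : Submodule ℂ (sl κ ℂ) where
  carrier := {A | ∀ a b, a ≠ c → A.1 a b = 0}
  add_mem' := fun hx hy a b h => by simp [hx a b h, hy a b h]
  zero_mem' := fun _ _ _ => rfl
  smul_mem' := fun c x hx a b h => by simp [hx a b h]

/-- The matrices supported on the column `c`. -/
def col (c : κ) : Submodule ℂ (sl κ ℂ) where
  carrier := {A | ∀ a b, b ≠ c → A.1 a b = 0}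
  add_mem' := fun hx hy a b h => by simp [hx a b h, hy a b h]
  zero_mem' := fun _ _ _ => rfl
  smul_mem' := fun c x hx a b h => by simp [hx a b h]

section IsContact

variable {d : κ → ℤ} {c : κ} (hd : IsContact d c)

include hd

theorem IsContact.elem_left_mem {i : κ} (hi : d i = 1) : (elem c i : sl κ ℂ) ∈ grade d (-1) := by
  have := elem_mem (d := d) c i
  rwa [hd.center, hi] at this

theorem IsContact.elem_right_mem {j : κ} (hj : d j = -1) : (elem j c : sl κ ℂ) ∈ grade d (-1) := by
  have := elem_mem (d := d) j c
  rwa [hd.center, hj] at this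

end IsContact

namespace Frame

variable {e f : Submodule ℂ L} {d : κ → ℤ} {c : κ} (F : Frame e f d) (hd : IsContact d c)

omit [Fintype κ] in
theorem left_le {S : Submodule ℂ L} (h : ∀ i, d i = 1 → F.x i ∈ S) : e ≤ S := by
  refine F.le_span_x.trans (Submodule.span_le.2 ?_)
  rintro _ ⟨i, rfl⟩
  by_cases hi : d i = 1
  · exact h i hi
  · rw [F.x_eq_zero i hi]; exact S.zero_mem

omit [Fintype κ] in
theorem right_le {S : Submodule ℂ L} (h : ∀ j, d j = -1 → F.y j ∈ S) : f ≤ S := by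
  refine F.le_span_y.trans (Submodule.span_le.2 ?_)
  rintro _ ⟨i, rfl⟩
  by_cases hi : d i = -1
  · exact h i hi
  · rw [F.y_eq_zero i hi]; exact S.zero_mem

theorem toSl_left_mem {S : Submodule ℂ (sl κ ℂ)} (h : ∀ i, d i = 1 → elem c i ∈ S) {z : L}
    (hz : z ∈ e) : F.toSl hd z ∈ S := by
  have : e ≤ S.comap (F.toSl hd).toLinearMap := F.left_le fun i hi => by
    change F.toSl hd (F.x i) ∈ S
    rw [F.toSl_x hd hi]
    exact h i hi
  exact this hz

theorem toSl_right_mem {S : Submodule ℂ (sl κ ℂ)} (h : ∀ j, d j = -1 → elem j c ∈ S) {z : L}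
    (hz : z ∈ f) : F.toSl hd z ∈ S := by
  have : f ≤ S.comap (F.toSl hd).toLinearMap := F.right_le fun i hi => by
    change F.toSl hd (F.y i) ∈ S
    rw [F.toSl_y hd hi]
    exact h i hi
  exact this hz

theorem toSl_left_mem_row {z : L} (hz : z ∈ e) : F.toSl hd z ∈ row c :=
  F.toSl_left_mem hd (S := row c) (fun i hi a b ha => by
    rw [elem_entry (hd.ne_of_pos hi).symm, if_neg fun h => ha h.1]) hz

theorem toSl_right_mem_col {z : L} (hz : z ∈ f) : F.toSl hd z ∈ col c :=
  F.toSl_right_mem hd (S := col c) (fun j hj a b hb => by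
    rw [elem_entry (hd.ne_of_neg hj), if_neg fun h => hb h.2]) hz

variable {M : GLA L}

theorem toSl_mem_grade [Nonempty κ] (hpp : IsPPFGLA M e f) (hk : M.IsOfKind 2)
    {p : ℤ} (hp : p < 0) {z : L} (hz : z ∈ M.g p) : F.toSl hd z ∈ grade d p := by
  have he : ∀ z ∈ e, F.toSl hd z ∈ grade d (-1) := fun z hz =>
    F.toSl_left_mem hd (fun i hi => hd.elem_left_mem hi) hz
  have hf : ∀ z ∈ f, F.toSl hd z ∈ grade d (-1) := fun z hz =>
    F.toSl_right_mem hd (fun i hi => hd.elem_right_mem hi) hz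
  obtain rfl | rfl | hp' : p = -1 ∨ p = -2 ∨ p < -2 := by omega
  · rw [← hpp.sup_eq] at hz
    exact (sup_le he hf : e ⊔ f ≤ (grade d (-1)).comap (F.toSl hd).toLinearMap) hz
  · refine (hpp.neg_two_le (S := (grade d (-2)).comap (F.toSl hd).toLinearMap)
      fun u hu v hv => ?_) hz
    change F.toSl hd ⁅u, v⁆ ∈ grade d (-2)
    rw [LieHom.map_lie]
    exact (gla d).bracket_mem (-1) (-1) _ (he u hu) _ (hf v hv)
  · rw [hk.2 p (by exact_mod_cast hp'), Submodule.mem_bot] at hz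
    rw [hz, map_zero]
    exact zero_mem _

include hd in
theorem ofSl_mem (hpp : IsPPFGLA M e f) {p : ℤ} {A : sl κ ℂ}
    (hA : A ∈ grade d p) : F.ofSl c A ∈ M.g p := by
  have hc := hd.center
  have hx : ∀ i, F.x i ∈ M.g (-1) := fun i => hpp.left_le (F.x_mem i)
  have hy : ∀ j, F.y j ∈ M.g (-1) := fun j => hpp.right_le (F.y_mem j)
  rw [ofSl_apply]
  refine sub_mem (add_mem (sum_mem fun i _ => ?_) (sum_mem fun j _ => ?_))
    (sum_mem fun i _ => sum_mem fun j _ => ?_)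
  · by_cases hi : d i = 1 ∧ p = -1
    · rw [hi.2]; exact Submodule.smul_mem _ _ (hx i)
    · by_cases hi' : d i = 1
      · rw [hA c i (by omega), zero_smul]; exact zero_mem _
      · rw [F.x_eq_zero i hi', smul_zero]; exact zero_mem _
  · by_cases hi : d j = -1 ∧ p = -1
    · rw [hi.2]; exact Submodule.smul_mem _ _ (hy j)
    · by_cases hi' : d j = -1
      · rw [hA j c (by omega), zero_smul]; exact zero_mem _
      · rw [F.y_eq_zero j hi', smul_zero]; exact zero_mem _
  · by_cases hi : d i = 1
    · by_cases hj : d j = -1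
      · by_cases hp2 : p = -2
        · rw [hp2]
          exact Submodule.smul_mem _ _ (M.bracket_mem (-1) (-1) _ (hx i) _ (hy j))
        · rw [hA j i (by omega), zero_smul]; exact zero_mem _
      · rw [F.y_eq_zero j hj, lie_zero, smul_zero]; exact zero_mem _
    · rw [F.x_eq_zero i hi, zero_lie, smul_zero]; exact zero_mem _

theorem map_toSl [Nonempty κ] (hpp : IsPPFGLA M e f) (hk : M.IsOfKind 2) {p : ℤ} (hp : p < 0) :
    (M.g p).map (F.toSl hd).toLinearMap = grade d p := by
  refine le_antisymm ?_ fun A hA => ⟨F.ofSl c A, F.ofSl_mem hd hpp hA, F.toSl_ofSl hd hp hA⟩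
  rintro _ ⟨z, hz, rfl⟩
  exact F.toSl_mem_grade hd hpp hk hp hz

theorem mem_map_left {A : sl κ ℂ} (hA : A ∈ grade d (-1)) (hA' : A ∈ row c) :
    A ∈ e.map (F.toSl hd).toLinearMap :=
  ⟨F.ofSl c A, F.ofSl_mem_left hd hA', F.toSl_ofSl hd (by norm_num) hA⟩

theorem mem_map_right {A : sl κ ℂ} (hA : A ∈ grade d (-1)) (hA' : A ∈ col c) :
    A ∈ f.map (F.toSl hd).toLinearMap :=
  ⟨F.ofSl c A, F.ofSl_mem_right hd hA', F.toSl_ofSl hd (by norm_num) hA⟩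

theorem lie_toSl_left_mem [Nonempty κ] {X : sl κ ℂ} (hX : X ∈ grade d 0) {z : L} (hz : z ∈ e) :
    ⁅X, F.toSl hd z⁆ ∈ e.map (F.toSl hd).toLinearMap := by
  have hc := hd.center
  refine F.toSl_left_mem hd (S := (e.map (F.toSl hd).toLinearMap).comap
    (LieAlgebra.ad ℂ (sl κ ℂ) X : sl κ ℂ →ₗ[ℂ] sl κ ℂ)) (fun i hi => ?_) hz
  refine F.mem_map_left hd ?_ fun a b ha => ?_
  · exact (gla d).bracket_mem 0 (-1) _ hX _ (hd.elem_left_mem hi)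
  · change ⁅X, elem c i⁆.1 a b = 0
    have := hX a c (by have := mt (hd.eq_zero_iff a).1 ha; omega)
    rw [lie_elem_entry _ (hd.ne_of_pos hi).symm, this]
    simp [ha]

theorem lie_toSl_right_mem [Nonempty κ] {X : sl κ ℂ} (hX : X ∈ grade d 0) {z : L} (hz : z ∈ f) :
    ⁅X, F.toSl hd z⁆ ∈ f.map (F.toSl hd).toLinearMap := by
  have hc := hd.center
  refine F.toSl_right_mem hd (S := (f.map (F.toSl hd).toLinearMap).comap
    (LieAlgebra.ad ℂ (sl κ ℂ) X : sl κ ℂ →ₗ[ℂ] sl κ ℂ)) (fun j hj => ?_) hz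
  refine F.mem_map_right hd ?_ fun a b hb => ?_
  · exact (gla d).bracket_mem 0 (-1) _ hX _ (hd.elem_right_mem hj)
  · change ⁅X, elem j c⁆.1 a b = 0
    have := hX c b (by have := mt (hd.eq_zero_iff b).1 hb; omega)
    rw [lie_elem_entry _ (hd.ne_of_neg hj), this]
    simp [hb]

end Frame

end SlGraded

namespace SlGraded

open LieAlgebra.SpecialLinear

variable {κ : Type} [Fintype κ] [DecidableEq κ]
variable {Lm LG : Type} [LieRing Lm] [LieAlgebra ℂ Lm] [LieRing LG] [LieAlgebra ℂ LG]

namespace Frame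

variable {M : GLA Lm} {e f : Submodule ℂ Lm} {G : GLA LG} {ι : Lm →ₗ⁅ℂ⁆ LG} {d : κ → ℤ} {c : κ}
variable (F : Frame e f d) (hd : IsContact d c)

theorem exists_preimage_step (h : IsPPExtension M e f G ι) (hpp : IsPPFGLA M e f)
    (hk : M.IsOfKind 2) {ψ : sl κ ℂ →ₗ⁅ℂ⁆ LG} (hinj : Function.Injective ψ)
    (hψ : ∀ p : ℤ, ∀ A ∈ grade d p, ψ A ∈ G.g p) (hψι : ∀ z, ψ (F.toSl hd z) = ι z)
    {p : ℤ} (hp : 0 ≤ p) (ih : ∀ X ∈ G.g (p - 1), ∃ A ∈ grade d (p - 1), ψ A = X)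
    {X : LG} (hX : X ∈ G.g p) : ∃ A ∈ grade d p, ψ A = X := by
  have hx : ∀ i, F.x i ∈ M.g (-1) := fun i => hpp.left_le (F.x_mem i)
  have hy : ∀ j, F.y j ∈ M.g (-1) := fun j => hpp.right_le (F.y_mem j)
  have hψx : ∀ i, d i = 1 → ψ (elem c i) = ι (F.x i) := fun i hi => by
    rw [← hψι, F.toSl_x hd hi]
  have hψy : ∀ j, d j = -1 → ψ (elem j c) = ι (F.y j) := fun j hj => by
    rw [← hψι, F.toSl_y hd hj]
  have hXz : ∀ z ∈ M.g (-1), ⁅X, ι z⁆ ∈ G.g (p - 1) := fun z hz =>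
    G.bracket_mem p (-1) _ hX _ (h.map_mem (by norm_num) hz)
  choose A hA hAX using fun i => ih _ (hXz _ (hx i))
  choose B hB hBX using fun j => ih _ (hXz _ (hy j))
  have key : ∃ H ∈ grade d p, (∀ i, d i = 1 → ⁅H, elem c i⁆ = A i) ∧
      ∀ j, d j = -1 → ⁅H, elem j c⁆ = B j := by
    obtain rfl | hp1 : p = 0 ∨ 1 ≤ p := by omega
    · refine hd.exists_inner_zero (fun i _ => hA i) (fun j _ => hB j) (fun i _ => ?_)
        fun j _ => ?_
      · obtain ⟨z, hz, hzX⟩ := h.e_stable X hX _ (F.x_mem i)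
        have : A i = F.toSl hd z := hinj (by rw [hAX, hψι]; exact hzX.symm)
        rw [this]
        exact F.toSl_left_mem_row hd hz
      · obtain ⟨z, hz, hzX⟩ := h.f_stable X hX _ (F.y_mem j)
        have : B j = F.toSl hd z := hinj (by rw [hBX, hψι]; exact hzX.symm)
        rw [this]
        exact F.toSl_right_mem_col hd hz
    · have hzero : ∀ u v w : Lm, u ∈ M.g (-1) → v ∈ M.g (-1) → w ∈ M.g (-1) →
          ⁅⁅X, ι u⁆, ⁅ι v, ι w⁆⁆ + ⁅ι u, ⁅⁅X, ι v⁆, ι w⁆ + ⁅ι v, ⁅X, ι w⁆⁆⁆ = 0 := by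
        intro u v w hu hv hw
        rw [← leibniz_lie, ← leibniz_lie, ← LieHom.map_lie, ← LieHom.map_lie,
          hk.lie_lie_eq_zero hu hv hw, map_zero, lie_zero]
      refine hd.exists_inner hp1 (fun i _ => hA i) (fun j _ => hB j)
        (fun i k j hi hk' hj => hinj ?_) fun j l i hi hj hl => hinj ?_
      · simp only [map_add, LieHom.map_lie, map_zero, hAX, hBX, hψx i hi, hψx k hk', hψy j hj]
        exact hzero _ _ _ (hx i) (hx k) (hy j)
      · simp only [map_add, LieHom.map_lie, map_zero, hAX, hBX, hψx i hi, hψy l hl, hψy j hj]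
        exact hzero _ _ _ (hy j) (hy l) (hx i)
  obtain ⟨H, hH, hHA, hHB⟩ := key
  refine ⟨H, hH, (sub_eq_zero.1 (h.eq_zero hpp hp (sub_mem hX (hψ p H hH)) ?_ ?_)).symm⟩
  · have : e ≤ LinearMap.ker
        ((LieAlgebra.ad ℂ LG (X - ψ H) : LG →ₗ[ℂ] LG) ∘ₗ ι.toLinearMap) := F.left_le fun i hi => by
      change ⁅X - ψ H, ι (F.x i)⁆ = 0
      rw [sub_lie, ← hAX, ← hψx i hi, ← LieHom.map_lie, hHA i hi, sub_self]
    exact fun z hz => this hz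
  · have : f ≤ LinearMap.ker
        ((LieAlgebra.ad ℂ LG (X - ψ H) : LG →ₗ[ℂ] LG) ∘ₗ ι.toLinearMap) := F.right_le fun i hi => by
      change ⁅X - ψ H, ι (F.y i)⁆ = 0
      rw [sub_lie, ← hBX, ← hψy i hi, ← LieHom.map_lie, hHB i hi, sub_self]
    exact fun z hz => this hz

theorem exists_preimage (h : IsPPExtension M e f G ι) (hpp : IsPPFGLA M e f)
    (hk : M.IsOfKind 2) {ψ : sl κ ℂ →ₗ⁅ℂ⁆ LG} (hinj : Function.Injective ψ)
    (hψ : ∀ p : ℤ, ∀ A ∈ grade d p, ψ A ∈ G.g p) (hψι : ∀ z, ψ (F.toSl hd z) = ι z)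
    {p : ℤ} {X : LG} (hX : X ∈ G.g p) : ∃ A, ψ A = X := by
  have : Nonempty κ := ⟨c⟩
  have hneg : ∀ p < 0, ∀ X ∈ G.g p, ∃ A ∈ grade d p, ψ A = X := by
    intro p hp X hX
    rw [← h.graded_neg p hp] at hX
    obtain ⟨z, hz, rfl⟩ := hX
    exact ⟨F.toSl hd z, F.toSl_mem_grade hd hpp hk hp hz, hψι z⟩
  have hnat : ∀ k : ℕ, ∀ X ∈ G.g ((k : ℤ) - 1), ∃ A ∈ grade d ((k : ℤ) - 1), ψ A = X := by
    intro k
    induction k with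
    | zero => exact hneg _ (by norm_num)
    | succ k ih =>
      intro X hX
      rw [Nat.cast_succ, add_sub_cancel_right] at hX ⊢
      exact F.exists_preimage_step hd h hpp hk hinj hψ hψι (by positivity) ih hX
  by_cases hp : p < 0
  · obtain ⟨A, -, hA⟩ := hneg p hp X hX
    exact ⟨A, hA⟩
  · obtain ⟨k, hk'⟩ := Int.eq_ofNat_of_zero_le (a := p + 1) (by omega)
    have : p = (k : ℤ) - 1 := by omega
    subst this
    obtain ⟨A, -, hA⟩ := hnat k X hX
    exact ⟨A, hA⟩

theorem exists_equiv (hpp : IsPPFGLA M e f) (hk : M.IsOfKind 2)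
    (hprol : IsPPProlongation M e f G ι) (F : Frame e f d) (hd : IsContact d c) :
    ∃ ψ : sl κ ℂ ≃ₗ⁅ℂ⁆ LG, ∀ p : ℤ, ∀ A ∈ grade d p, ψ A ∈ G.g p := by
  have : Nonempty κ := ⟨c⟩
  obtain ⟨ψ, hinj, hψ, hψι⟩ := hprol.max (sl κ ℂ) (gla d) (F.toSl hd) (F.toSl_injective hd hpp hk)
    (fun p hp => F.map_toSl hd hpp hk hp) hd.gla_transitive
    (fun X hX z hz => F.lie_toSl_left_mem hd hX hz)
    (fun X hX z hz => F.lie_toSl_right_mem hd hX hz)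
  have hψ' : ∀ p : ℤ, ∀ A ∈ grade d p, ψ A ∈ G.g p := fun p A hA => hψ p ⟨A, hA, rfl⟩
  have hext : IsPPExtension M e f G ι :=
    ⟨hprol.inj, hprol.graded_neg, hprol.trans, hprol.e_stable, hprol.f_stable⟩
  have hrange : (⊤ : Submodule ℂ LG) ≤ LinearMap.range ψ.toLinearMap := by
    rw [← G.internal.submodule_iSup_eq_top]
    refine iSup_le fun p X hX => ?_
    exact F.exists_preimage hd hext hpp hk hinj hψ' (fun z => LieHom.congr_fun hψι z) hX
  exact ⟨LieEquiv.ofBijective ψ ⟨hinj, fun X => hrange Submodule.mem_top⟩, hψ'⟩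

end Frame

end SlGraded

namespace SlGraded

open LieAlgebra.SpecialLinear

section Simple

variable {κ : Type} [Fintype κ] [DecidableEq κ]

theorem lie_elem_elem_eq_zero {i j k l : κ} (hij : i ≠ j) (hkl : k ≠ l) (hjk : j ≠ k)
    (hil : i ≠ l) : ⁅(elem i j : sl κ ℂ), elem k l⁆ = 0 := by
  refine ext_entry fun a b => ?_
  rw [lie_elem_entry _ hkl, elem_entry hij, elem_entry hij, zero_entry]
  grind

theorem lie_diagSub_diagSub (i j k l : κ) : ⁅(diagSub i j : sl κ ℂ), diagSub k l⁆ = 0 := by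
  refine ext_entry fun a b => ?_
  rw [lie_entry, zero_entry, sub_eq_zero]
  refine Finset.sum_congr rfl fun x _ => ?_
  simp only [diagSub_entry]
  by_cases hax : a = x
  · by_cases hxb : x = b
    · subst hax hxb
      ring
    · subst hax
      grind
  · grind

theorem lie_elem_lie_elem {i j : κ} (hij : i ≠ j) (A : sl κ ℂ) :
    ⁅elem i j, ⁅elem i j, A⁆⁆ = (-2 * A.1 j i) • (elem i j : sl κ ℂ) := by
  refine ext_entry fun a b => ?_
  rw [elem_lie_entry _ hij, elem_lie_entry _ hij, elem_lie_entry _ hij, smul_entry, elem_entry hij]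
  grind

theorem exists_elem_mem_of_ne_bot {I : LieIdeal ℂ (sl κ ℂ)} (hI : I ≠ ⊥) :
    ∃ i j, i ≠ j ∧ elem i j ∈ I := by
  obtain ⟨A, hA, hA0⟩ : ∃ A ∈ I, A ≠ 0 := by
    by_contra! h
    exact hI ((LieSubmodule.eq_bot_iff I).2 h)
  by_cases hoff : ∃ i j, i ≠ j ∧ A.1 j i ≠ 0
  · obtain ⟨i, j, hij, hne⟩ := hoff
    have h1 : ⁅elem i j, ⁅elem i j, A⁆⁆ ∈ I := I.lie_mem (I.lie_mem hA)
    rw [lie_elem_lie_elem hij] at h1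
    refine ⟨i, j, hij, ?_⟩
    exact (I.toSubmodule.smul_mem_iff (mul_ne_zero (by norm_num) hne)).1 h1
  · push Not at hoff
    have hdiag : ∃ i j, A.1 i i ≠ A.1 j j := by
      by_contra! hcon
      refine hA0 (ext_entry fun a b => ?_)
      by_cases hab : a = b
      · subst hab
        have h1 := sum_diag A
        rw [Finset.sum_congr rfl fun b _ => hcon b a, Finset.sum_const, nsmul_eq_mul] at h1
        have : Nonempty κ := ⟨a⟩
        exact (mul_eq_zero.1 h1).resolve_left
          (by rw [Finset.card_univ]; exact_mod_cast Fintype.card_ne_zero)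
      · exact hoff b a (Ne.symm hab)
    obtain ⟨i, j, hne⟩ := hdiag
    have hij : i ≠ j := fun h => hne (by rw [h])
    have h1 : ⁅elem i j, A⁆ ∈ I := I.lie_mem hA
    have h2 : ⁅elem i j, A⁆ = (A.1 j j - A.1 i i) • (elem i j : sl κ ℂ) := by
      refine ext_entry fun a b => ?_
      rw [elem_lie_entry _ hij, smul_entry, elem_entry hij]
      have h3 := hoff b j
      have h4 := hoff i a
      grind
    rw [h2] at h1
    exact ⟨i, j, hij, (I.toSubmodule.smul_mem_iff (sub_ne_zero.2 hne.symm)).1 h1⟩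

theorem eq_top_of_elem_mem {I : LieIdeal ℂ (sl κ ℂ)} {i j : κ} (hij : i ≠ j)
    (h : elem i j ∈ I) : I = ⊤ := by
  have hr : ∀ a b c, a ≠ b → a ≠ c → elem a b ∈ I → elem a c ∈ I := by
    intro a b c hab hac hI
    by_cases hbc : b = c
    · rwa [← hbc]
    · rw [← lie_elem_elem hab hbc hac, ← lie_skew]
      exact I.neg_mem (I.lie_mem hI)
  have hl : ∀ a b c, a ≠ b → c ≠ b → elem a b ∈ I → elem c b ∈ I := by
    intro a b c hab hcb hI
    by_cases hca : c = a
    · rwa [hca]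
    · rw [← lie_elem_elem hca hab hcb]
      exact I.lie_mem hI
  have hs : ∀ a b, a ≠ b → elem a b ∈ I → elem b a ∈ I := by
    intro a b hab hI
    have h1 : ⁅elem b a, ⁅elem b a, elem a b⁆⁆ ∈ I := I.lie_mem (I.lie_mem hI)
    rw [lie_elem_lie_elem hab.symm, elem_entry hab, if_pos ⟨rfl, rfl⟩] at h1
    exact (I.toSubmodule.smul_mem_iff (by norm_num)).1 h1
  have hall : ∀ a b, a ≠ b → elem a b ∈ I := by
    intro a b hab
    by_cases haj : a = j
    · subst haj
      exact hr a i b hij.symm hab (hs i a hij h)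
    · exact hr a j b haj hab (hl i j a hij haj h)
  have : Nonempty κ := ⟨i⟩
  have := eq_top_of_mem I.toSubmodule hall fun a b hab => by
    rw [← lie_elem_elem_self hab]
    exact I.lie_mem (hall b a hab.symm)
  exact (LieSubmodule.toSubmodule_eq_top _).1 this

theorem isSimple_of_equiv [Nontrivial κ] {L : Type} [LieRing L] [LieAlgebra ℂ L]
    (ψ : sl κ ℂ ≃ₗ⁅ℂ⁆ L) : LieAlgebra.IsSimple ℂ L where
  eq_bot_or_eq_top I := by
    by_cases hI : I = ⊥
    · exact Or.inl hI
    · right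
      have hJ : I.comap (ψ : sl κ ℂ →ₗ⁅ℂ⁆ L) ≠ ⊥ := by
        refine fun hbot => hI ((LieSubmodule.eq_bot_iff I).2 fun z hz => ?_)
        have h1 : ψ.symm z = 0 := (LieSubmodule.eq_bot_iff _).1 hbot _ <| by
          rw [LieIdeal.mem_comap]
          change ψ (ψ.symm z) ∈ I
          rwa [LieEquiv.apply_symm_apply]
        rw [← ψ.apply_symm_apply z, h1, map_zero]
      obtain ⟨i, j, hij, hmem⟩ := exists_elem_mem_of_ne_bot hJ
      have htop := eq_top_of_elem_mem hij hmem
      rw [eq_top_iff]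
      intro z _
      have : ψ.symm z ∈ I.comap (ψ : sl κ ℂ →ₗ⁅ℂ⁆ L) := htop ▸ LieSubmodule.mem_top _
      rw [LieIdeal.mem_comap] at this
      change ψ (ψ.symm z) ∈ I at this
      rwa [LieEquiv.apply_symm_apply] at this
  non_abelian h := by
    obtain ⟨i, j, hij⟩ := exists_pair_ne κ
    have h1 : ψ ⁅elem i j, elem j i⁆ = 0 := by
      rw [LieEquiv.map_lie]
      exact h.trivial _ _
    rw [lie_elem_elem_self hij, ← map_zero ψ] at h1
    have h2 := congrArg (fun A : sl κ ℂ => A.1 i i) (ψ.injective h1)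
    simp [diagSub_entry, hij] at h2

end Simple

section Chevalley

variable {l : ℕ}

theorem linearIndependent_diagSub : LinearIndependent ℂ
    (fun k : Fin l => (diagSub k.castSucc k.succ : sl (Fin (l + 1)) ℂ)) := by
  rw [Fintype.linearIndependent_iff]
  intro g hg
  have key : ∀ (n : ℕ) (hn : n < l), g ⟨n, hn⟩ = 0 := by
    intro n
    induction n using Nat.strong_induction_on with
    | _ n ih =>
      intro hn
      have h1 := congrArg (fun A : sl (Fin (l + 1)) ℂ =>
        A.1 (Fin.castSucc ⟨n, hn⟩) (Fin.castSucc ⟨n, hn⟩)) hg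
      simp only [sum_entry, smul_entry, diagSub_entry, zero_entry] at h1
      rw [Finset.sum_eq_single ⟨n, hn⟩] at h1
      · simpa [Fin.ext_iff] using h1
      · intro b _ hb
        by_cases hbn : (b : ℕ) + 1 = n
        · rw [show g b = 0 from ih b (by omega) b.2, zero_mul]
        · have h2 : (b : ℕ) ≠ n := fun h => hb (Fin.ext h)
          simp [Fin.ext_iff, Ne.symm h2, Ne.symm hbn]
      · simp
  exact fun k => key k k.2

theorem subalgebra_eq_top {S : LieSubalgebra ℂ (sl (Fin (l + 1)) ℂ)}
    (he : ∀ k : Fin l, elem k.castSucc k.succ ∈ S)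
    (hf : ∀ k : Fin l, elem k.succ k.castSucc ∈ S) : S = ⊤ := by
  have hsucc : ∀ a b : Fin (l + 1), (b : ℕ) = a + 1 → elem a b ∈ S ∧ elem b a ∈ S := by
    intro a b hab
    obtain ⟨k, rfl, rfl⟩ : ∃ k : Fin l, a = k.castSucc ∧ b = k.succ :=
      ⟨⟨a, by omega⟩, rfl, Fin.ext hab⟩
    exact ⟨he k, hf k⟩
  have hup : ∀ (q : ℕ) (a b : Fin (l + 1)), (b : ℕ) = a + q + 1 →
      elem a b ∈ S ∧ elem b a ∈ S := by
    intro q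
    induction q with
    | zero => exact hsucc
    | succ q ih =>
      intro a b hab
      obtain ⟨h1, h2⟩ := ih a ⟨a + q + 1, by omega⟩ rfl
      have h3 := hsucc ⟨a + q + 1, by omega⟩ b (by simp; omega)
      have h4 : a ≠ ⟨a + q + 1, by omega⟩ := fun h => by simp [Fin.ext_iff] at h; omega
      have h5 : (⟨a + q + 1, by omega⟩ : Fin (l + 1)) ≠ b :=
        fun h => by simp [Fin.ext_iff] at h; omega
      have h6 : a ≠ b := fun h => by simp [Fin.ext_iff] at h; omega
      rw [← lie_elem_elem h4 h5 h6, ← lie_elem_elem h5.symm h4.symm h6.symm]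
      exact ⟨S.lie_mem h1 h3.1, S.lie_mem h3.2 h2⟩
  have hall : ∀ a b : Fin (l + 1), a ≠ b → elem a b ∈ S := by
    intro a b hab
    have : (a : ℕ) ≠ b := fun h => hab (Fin.ext h)
    obtain h | h : (a : ℕ) < b ∨ (b : ℕ) < a := by omega
    · exact (hup (b - a - 1) a b (by omega)).1
    · exact (hup (a - b - 1) b a (by omega)).2
  have := eq_top_of_mem S.toSubmodule hall fun a b hab => by
    rw [← lie_elem_elem_self hab]
    exact S.lie_mem (hall a b hab) (hall b a hab.symm)
  exact LieSubalgebra.toSubmodule_injective this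

theorem lie_diagSub_elem_succ (i j : Fin l) :
    ⁅(diagSub i.castSucc i.succ : sl (Fin (l + 1)) ℂ), elem j.castSucc j.succ⁆ =
      cartanA l i j • elem j.castSucc j.succ := by
  rw [lie_diagSub_elem _ _ Fin.castSucc_lt_succ.ne, Int.cast_smul_eq_zsmul]
  congr 1
  simp only [cartanA, Matrix.of_apply, Fin.ext_iff, Fin.val_castSucc, Fin.val_succ]
  grind

theorem lie_diagSub_elem_castSucc (i j : Fin l) :
    ⁅(diagSub i.castSucc i.succ : sl (Fin (l + 1)) ℂ), elem j.succ j.castSucc⁆ =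
      (-(cartanA l i j)) • elem j.succ j.castSucc := by
  rw [lie_diagSub_elem _ _ Fin.castSucc_lt_succ.ne', Int.cast_smul_eq_zsmul]
  congr 1
  simp only [cartanA, Matrix.of_apply, Fin.ext_iff, Fin.val_castSucc, Fin.val_succ]
  grind

theorem elem_ne_zero {κ : Type} [Fintype κ] [DecidableEq κ] {i j : κ} (h : i ≠ j) :
    (elem i j : sl κ ℂ) ≠ 0 := fun h0 => by
  have := congrArg (fun A : sl κ ℂ => A.1 i j) h0
  simp [elem_entry h] at this

theorem isSimpleGLAOfType {LG : Type} [LieRing LG] [LieAlgebra ℂ LG] {G : GLA LG}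
    {d : Fin (l + 1) → ℤ} (hl : 1 ≤ l) (ψ : sl (Fin (l + 1)) ℂ ≃ₗ⁅ℂ⁆ LG)
    (hψ : ∀ p : ℤ, ∀ A ∈ grade d p, ψ A ∈ G.g p) {Pi1 : Finset (Fin l)}
    (hPi : ∀ k : Fin l, d k.castSucc - d k.succ = if k ∈ Pi1 then 1 else 0) :
    IsSimpleGLAOfType G (cartanA l) Pi1 := by
  have : Nontrivial (Fin (l + 1)) := Fin.nontrivial_iff_two_le.2 (by omega)
  have hne : ∀ k : Fin l, k.castSucc ≠ k.succ := fun k => Fin.castSucc_lt_succ.ne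
  refine ⟨ψ.toLinearEquiv.finiteDimensional, isSimple_of_equiv ψ,
    fun k => ψ (diagSub k.castSucc k.succ), fun k => ψ (elem k.castSucc k.succ),
    fun k => ψ (elem k.succ k.castSucc), ?_, fun k => ?_, fun k => ?_, fun i j => ?_, fun k => ?_,
    fun i j hij => ?_, fun i j => ?_, fun i j => ?_, ?_, fun k => ?_, fun k => ?_, fun k => ?_⟩
  · exact linearIndependent_diagSub.map' ψ.toLinearEquiv.toLinearMap ψ.toLinearEquiv.ker
  · exact fun h => elem_ne_zero (hne k) (ψ.injective (h.trans (map_zero ψ).symm))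
  · exact fun h => elem_ne_zero (hne k).symm (ψ.injective (h.trans (map_zero ψ).symm))
  · rw [← LieEquiv.map_lie, lie_diagSub_diagSub, map_zero]
  · rw [← LieEquiv.map_lie, lie_elem_elem_self (hne k)]
  · rw [← LieEquiv.map_lie, lie_elem_elem_eq_zero (hne i) (hne j).symm
      (fun h => hij (Fin.succ_injective _ h)) (fun h => hij (Fin.castSucc_injective _ h)), map_zero]
  · rw [← LieEquiv.map_lie, lie_diagSub_elem_succ, map_zsmul]
  · rw [← LieEquiv.map_lie, lie_diagSub_elem_castSucc, map_zsmul]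
  · have h1 : ∀ z ∈ (Set.range fun k : Fin l => ψ (elem k.castSucc k.succ)) ∪
        Set.range fun k : Fin l => ψ (elem k.succ k.castSucc), z ∈ LieSubalgebra.lieSpan ℂ LG _ :=
      fun z hz => LieSubalgebra.subset_lieSpan hz
    have h2 := subalgebra_eq_top
      (S := (LieSubalgebra.lieSpan ℂ LG ((Set.range fun k : Fin l => ψ (elem k.castSucc k.succ)) ∪
        Set.range fun k : Fin l => ψ (elem k.succ k.castSucc))).comap
          (ψ : sl (Fin (l + 1)) ℂ →ₗ⁅ℂ⁆ LG))
      (fun k => h1 _ (Or.inl ⟨k, rfl⟩)) (fun k => h1 _ (Or.inr ⟨k, rfl⟩))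
    rw [eq_top_iff]
    intro z _
    have h3 : ψ.symm z ∈ (⊤ : LieSubalgebra ℂ (sl (Fin (l + 1)) ℂ)) := LieSubalgebra.mem_top _
    rw [← h2] at h3
    rw [LieSubalgebra.mem_comap] at h3
    rw [← ψ.apply_symm_apply z]
    exact h3
  · exact hψ 0 _ (diagSub_mem _ _)
  · exact hψ _ _ (hPi k ▸ elem_mem _ _)
  · have := elem_mem (d := d) k.succ k.castSucc
    rw [← neg_sub, hPi k] at this
    exact hψ _ _ this

end Chevalley

end SlGraded

namespace SlGraded

/-- The weights defining the contact gradation of `sl (Fin (m + n + 1)) ℂ`. -/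
def contactWeight (m n : ℕ) (a : Fin (m + n + 1)) : ℤ :=
  if (a : ℕ) < m then 1 else if (a : ℕ) = m then 0 else -1

theorem contactWeight_eq_one {m n : ℕ} {a : Fin (m + n + 1)} :
    contactWeight m n a = 1 ↔ (a : ℕ) < m := by
  rw [contactWeight]; grind

theorem contactWeight_eq_neg_one {m n : ℕ} {a : Fin (m + n + 1)} :
    contactWeight m n a = -1 ↔ m < (a : ℕ) := by
  rw [contactWeight]; grind

theorem isContact_contactWeight {m n : ℕ} (hm : 1 ≤ m) (hn : 1 ≤ n) :
    IsContact (contactWeight m n) ⟨m, by omega⟩ where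
  eq_zero_iff a := by rw [contactWeight, Fin.ext_iff]; grind
  cases a := by rw [contactWeight]; grind
  exists_pos := ⟨⟨0, by omega⟩, contactWeight_eq_one.2 hm⟩
  exists_neg := ⟨⟨m + 1, by omega⟩, contactWeight_eq_neg_one.2 (Nat.lt_succ_self m)⟩

theorem card_contactWeight_eq_one (m n : ℕ) :
    Fintype.card {a // contactWeight m n a = 1} = m := by
  let E : {a // contactWeight m n a = 1} ≃ Fin m :=
    { toFun := fun a => ⟨a.1, contactWeight_eq_one.1 a.2⟩
      invFun := fun k => ⟨⟨k, by omega⟩, contactWeight_eq_one.2 k.2⟩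
      left_inv := fun _ => rfl
      right_inv := fun _ => rfl }
  exact (Fintype.card_congr E).trans (Fintype.card_fin m)

theorem card_contactWeight_eq_neg_one (m n : ℕ) :
    Fintype.card {a // contactWeight m n a = -1} = n := by
  let E : {a // contactWeight m n a = -1} ≃ Fin n :=
    { toFun := fun a => ⟨a.1 - (m + 1), by
        have := contactWeight_eq_neg_one.1 a.2
        omega⟩
      invFun := fun k => ⟨⟨k + (m + 1), by omega⟩, contactWeight_eq_neg_one.2 (by simp only; omega)⟩
      left_inv := fun a => by
        have := contactWeight_eq_neg_one.1 a.2
        refine Subtype.ext (Fin.ext ?_)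
        simp only
        omega
      right_inv := fun k => Fin.ext (by simp) }
  exact (Fintype.card_congr E).trans (Fintype.card_fin n)

end SlGraded

/-- Theorem 8.1 (2): if the prolongation `g` of a free pseudo-product FGLA of type
`(m, n, μ)` has `g₁ ≠ 0`, then `μ = 2` and `g` is the finite-dimensional simple
graded Lie algebra of type `(A_{m+n}, {α_m, α_{m+1}})`. -/
theorem free_pp_fgla_prolongation_simple {Lm LG : Type}
    [LieRing Lm] [LieAlgebra ℂ Lm] [LieRing LG] [LieAlgebra ℂ LG]
    (M : GLA Lm) (e f : Submodule ℂ Lm) (m n μ : ℕ)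
    (hm : 1 ≤ m) (hn : 1 ≤ n) (hμ : 2 ≤ μ)
    (hfree : IsFreePPFGLA M e f m n μ)
    (G : GLA LG) (ι : Lm →ₗ⁅ℂ⁆ LG) (hprol : IsPPProlongation M e f G ι)
    (h1 : G.g 1 ≠ ⊥) :
    μ = 2 ∧ IsSimpleGLAOfType G (cartanA (m + n))
      ({⟨m - 1, by omega⟩, ⟨m, by omega⟩} : Finset (Fin (m + n))) := by

  have hext : IsPPExtension M e f G ι :=
    ⟨hprol.inj, hprol.graded_neg, hprol.trans, hprol.e_stable, hprol.f_stable⟩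
  obtain rfl : μ = 2 := by
    by_contra hne
    exact h1 (hext.g_one_eq_bot hfree (by omega))
  refine ⟨rfl, ?_⟩
  have hd := SlGraded.isContact_contactWeight hm hn
  obtain ⟨F⟩ := SlGraded.exists_frame hd hfree (SlGraded.card_contactWeight_eq_one m n)
    (SlGraded.card_contactWeight_eq_neg_one m n)
  obtain ⟨ψ, hψ⟩ := SlGraded.Frame.exists_equiv hfree.1 hfree.2.1 hprol F hd
  refine SlGraded.isSimpleGLAOfType (by omega) ψ hψ fun k => ?_
  simp only [SlGraded.contactWeight, Fin.val_castSucc, Fin.val_succ, Finset.mem_insert,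
    Finset.mem_singleton, Fin.ext_iff]
  grind
end

section
/- Let m = ⊕_{p<0} g_p be a free fundamental graded Lie algebra over ℂ and let g(m) = ⊕_{p∈ℤ} g(m)_p be the prolongation of m. Then the map Φ: Aut(g(m))_0 → GL(g_{-1}), φ ↦ φ|g_{-1}, is a group isomorphism. -/
open scoped TensorProduct

namespace GLA

variable {L L' : Type} [LieRing L] [LieAlgebra ℂ L] [LieRing L'] [LieAlgebra ℂ L']

/-- Linear maps that agree on every homogeneous component are equal. -/
lemma linearMap_ext (G : GLA L) {f f' : L →ₗ[ℂ] L'}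
    (h : ∀ p, ∀ x ∈ G.g p, f x = f' x) : f = f' := by
  have hle : ⨆ p, G.g p ≤ LinearMap.eqLocus f f' := iSup_le fun p x hx => h p x hx
  rw [G.internal.submodule_iSup_eq_top] at hle
  exact LinearMap.ext fun x => hle Submodule.mem_top

/-- Lie algebra homomorphisms out of an FGLA are determined by their values in degree `-1`. -/
lemma IsFGLA.lieHom_ext {G : GLA L} (hG : G.IsFGLA) {f f' : L →ₗ⁅ℂ⁆ L'}
    (h : ∀ x ∈ G.g (-1), f x = f' x) : f = f' := by
  have key : ∀ k : ℕ, ∀ x ∈ G.g (-1 - (k : ℤ)), f x = f' x := by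
    intro k
    induction k with
    | zero => simpa using h
    | succ k ih =>
      intro x hx
      rw [show (-1 - ((k + 1 : ℕ) : ℤ)) = (-1 - (k : ℤ)) - 1 by push_cast; ring,
        hG.generated _ (by omega)] at hx
      have hle : Submodule.span ℂ {z : L | ∃ x ∈ G.g (-1 - (k : ℤ)), ∃ y ∈ G.g (-1), z = ⁅x, y⁆}
          ≤ LinearMap.eqLocus f.toLinearMap f'.toLinearMap := by
        rw [Submodule.span_le]
        rintro z ⟨u, hu, v, hv, rfl⟩
        change f ⁅u, v⁆ = f' ⁅u, v⁆
        rw [LieHom.map_lie, LieHom.map_lie, ih u hu, h v hv]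
      exact hle hx
  have hlin : f.toLinearMap = f'.toLinearMap := by
    refine G.linearMap_ext fun p x hx => ?_
    rcases le_or_gt 0 p with hp | hp
    · rw [hG.nonneg p hp, Submodule.mem_bot] at hx
      simp [hx]
    · obtain ⟨k, hk⟩ := Int.eq_ofNat_of_zero_le (show 0 ≤ -1 - p by omega)
      exact key k x (by rwa [show -1 - (k : ℤ) = p by omega])
  exact LieHom.ext fun x => LinearMap.congr_fun hlin x

/-- An injective linear endomorphism preserving each homogeneous component maps each
component onto itself. -/
lemma map_eq_of_injective (G : GLA L) {f : L →ₗ[ℂ] L} (hf : Function.Injective f)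
    (h : ∀ p, (G.g p).map f ≤ G.g p) (p : ℤ) : (G.g p).map f = G.g p := by
  have := G.findim p
  exact Submodule.eq_of_le_of_finrank_eq (h p)
    (LinearEquiv.finrank_eq (Submodule.equivMapOfInjective f hf (G.g p))).symm

/-- A linear endomorphism mapping each homogeneous component onto itself is surjective. -/
lemma surjective_of_map_eq (G : GLA L) {f : L →ₗ[ℂ] L}
    (h : ∀ p, (G.g p).map f = G.g p) : Function.Surjective f := by
  rw [← LinearMap.range_eq_top, LinearMap.range_eq_map,
    ← G.internal.submodule_iSup_eq_top, Submodule.map_iSup]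
  simp_rw [h]

/-- Graded automorphisms of a transitive GLA are determined by their values in negative
degrees. -/
lemma Transitive.lieEquiv_ext {G : GLA L} (hG : G.Transitive) {f f' : L ≃ₗ⁅ℂ⁆ L}
    (hf : ∀ p, (G.g p).map (f : L →ₗ⁅ℂ⁆ L).toLinearMap = G.g p)
    (hf' : ∀ p, (G.g p).map (f' : L →ₗ⁅ℂ⁆ L).toLinearMap = G.g p)
    (h : ∀ p : ℤ, p < 0 → ∀ x ∈ G.g p, f x = f' x) : f = f' := by
  have key : ∀ k : ℕ, ∀ p : ℤ, p < k → ∀ x ∈ G.g p, f x = f' x := by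
    intro k
    induction k with
    | zero => simpa using h
    | succ k ih =>
      intro p hp x hx
      rcases lt_or_ge p 0 with hp0 | hp0
      · exact h p hp0 x hx
      have hfx : f x ∈ G.g p := by
        rw [← hf p]; exact Submodule.mem_map_of_mem hx
      have hfx' : f' x ∈ G.g p := by
        rw [← hf' p]; exact Submodule.mem_map_of_mem hx
      refine sub_eq_zero.mp (hG p hp0 _ (sub_mem hfx hfx') fun q hq y hy => ?_)
      rw [← hf q] at hy
      obtain ⟨z, hz, rfl⟩ := hy
      change ⁅f x - f' x, f z⁆ = 0
      have hxz := ih (p + q) (by push_cast at hp; omega) _ (G.bracket_mem p q x hx z hz)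
      rw [LieEquiv.map_lie, LieEquiv.map_lie, ← h q hq z hz] at hxz
      rw [sub_lie, hxz, sub_self]
  have hlin : (f : L →ₗ⁅ℂ⁆ L).toLinearMap = (f' : L →ₗ⁅ℂ⁆ L).toLinearMap :=
    G.linearMap_ext fun p x hx => key (p.toNat + 1) p (by push_cast; omega) x hx
  exact LieEquiv.coe_injective (funext fun x => LinearMap.congr_fun hlin x)

end GLA

/-- Every linear automorphism of the degree `-1` part of a free FGLA extends to a graded
Lie algebra endomorphism. -/
lemma IsFreeFGLA.exists_extension {L : Type} [LieRing L] [LieAlgebra ℂ L] {M : GLA L} {n μ : ℕ}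
    (h : IsFreeFGLA M n μ) (ψ : (M.g (-1)) ≃ₗ[ℂ] (M.g (-1))) :
    ∃ α : L →ₗ⁅ℂ⁆ L, (∀ p, (M.g p).map α.toLinearMap ≤ M.g p) ∧
      ∀ x : M.g (-1), α (x : L) = (ψ x : L) := by
  obtain ⟨α, ⟨h₁, -, h₂⟩, -⟩ := h.2.2.2 L M h.1 h.2.1 ψ.toLinearMap ψ.surjective
  exact ⟨α, fun p => Submodule.map_le_iff_le_comap.mpr fun x hx => h₁ p x hx, h₂⟩

/-- For a free FGLA `m` with prolongation `g(m)`, the restriction map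
`Aut(g(m))₀ → GL(g₋₁)` is a group isomorphism: every linear automorphism of `g₋₁`
extends uniquely to a gradation-preserving automorphism of `g(m)`. -/
theorem free_fgla_prolongation_aut_iso_gl {Lm LG : Type} [LieRing Lm] [LieAlgebra ℂ Lm]
    [LieRing LG] [LieAlgebra ℂ LG]
    (M : GLA Lm) (n μ : ℕ) (hμ : 2 ≤ μ) (hfree : IsFreeFGLA M n μ)
    (G : GLA LG) (ι : Lm →ₗ⁅ℂ⁆ LG) (hprol : IsProlongation M G ι) :
    ∀ ψ : (M.g (-1)) ≃ₗ[ℂ] (M.g (-1)),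
      ∃! φ : LG ≃ₗ⁅ℂ⁆ LG,
        (∀ p : ℤ, (G.g p).map (φ : LG →ₗ⁅ℂ⁆ LG).toLinearMap = G.g p) ∧
        ∀ x : M.g (-1), φ (ι (x : Lm)) = ι ((ψ x : Lm)) := by
  have hM : M.IsFGLA := hfree.1
  intro ψ
  obtain ⟨α, -, hα⟩ := hfree.exists_extension ψ
  obtain ⟨β, hβg, hβ⟩ := hfree.exists_extension ψ.symm
  have hαβ : α.comp β = LieHom.id := hM.lieHom_ext fun x hx => by
    have h := hα (ψ.symm ⟨x, hx⟩)
    rw [← hβ, ψ.apply_symm_apply] at h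
    exact h
  have hβα : β.comp α = LieHom.id := hM.lieHom_ext fun x hx => by
    have h := hβ (ψ ⟨x, hx⟩)
    rw [← hα, ψ.symm_apply_apply] at h
    exact h
  have hβinj : Function.Injective β :=
    Function.LeftInverse.injective (g := α) fun x => LieHom.congr_fun hαβ x
  obtain ⟨Φ, hΦinj, hΦg, hΦ⟩ := hprol.max LG G (ι.comp β) (hprol.inj.comp hβinj)
    (fun p hp => by
      rw [LieHom.toLinearMap_comp, Submodule.map_comp, M.map_eq_of_injective hβinj hβg p,
        hprol.graded_neg p hp]) hprol.trans
  have hΦmap := G.map_eq_of_injective hΦinj hΦg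
  let φ : LG ≃ₗ⁅ℂ⁆ LG := LieEquiv.ofBijective Φ ⟨hΦinj, G.surjective_of_map_eq hΦmap⟩
  have hφ : ∀ p : ℤ, (G.g p).map (φ : LG →ₗ⁅ℂ⁆ LG).toLinearMap = G.g p := hΦmap
  have hφι : ∀ x : M.g (-1), φ (ι (x : Lm)) = ι ((ψ x : Lm)) := fun x => by
    have h₁ : β (α x) = x := LieHom.congr_fun hβα x
    have h₂ : Φ (ι (β (α x))) = ι (α x) := LieHom.congr_fun hΦ (α x)
    rw [h₁, hα] at h₂
    exact h₂
  refine ⟨φ, ⟨hφ, hφι⟩, fun φ' ⟨hφ', hφι'⟩ => hprol.trans.lieEquiv_ext hφ' hφ ?_⟩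
  have hcomp : (φ' : LG →ₗ⁅ℂ⁆ LG).comp ι = (φ : LG →ₗ⁅ℂ⁆ LG).comp ι :=
    hM.lieHom_ext fun x hx => (hφι' ⟨x, hx⟩).trans (hφι ⟨x, hx⟩).symm
  intro p hp x hx
  rw [← hprol.graded_neg p hp] at hx
  obtain ⟨y, -, rfl⟩ := hx
  exact LieHom.congr_fun hcomp y
end
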